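/- arXiv:1010.5042 — 5 statements merged into one kernel-verified Lean document; each statement's English description precedes it below -/
import Mathlib

section
/- For every positive integer n and any integers a_1, …, a_n, there exists a non-empty subset I ⊆ {1, …, n} such that n divides Σ_{i∈I} a_i and Σ_{i∈I} gcd(a_i, n) ≤ n. -/
open Multiset Finset

/-- The cross number of a sequence (multiset) over an additive group:
    the sum of the reciprocals of the orders of its elements. -/
noncomputable def crossNum {G : Type*} [AddCommGroup G] (S : Multiset G) : ℝ :=
  (S.map fun g => (1 : ℝ) / (addOrderOf g : ℝ)).sum

/-- A tiny zero-sum sequence: non-empty, zero sum, cross number at most 1. -/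
def IsTinyZS {G : Type*} [AddCommGroup G] (S' : Multiset G) : Prop :=
  S' ≠ 0 ∧ S'.sum = 0 ∧ crossNum S' ≤ 1

/-- `tC G` : the smallest `t ≥ 1` such that every sequence over `G` of length `≥ t`
    contains a tiny zero-sum subsequence. -/
noncomputable def tC (G : Type*) [AddCommGroup G] : ℕ :=
  sInf {t : ℕ | 0 < t ∧ ∀ S : Multiset G, t ≤ Multiset.card S → ∃ S' ≤ S, IsTinyZS S'}

/-- `etaC G` : the smallest `t ≥ 1` such that every sequence over `G` of length `≥ t`
    contains a non-empty zero-sum subsequence of length at most `exp(G)`. -/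
noncomputable def etaC (G : Type*) [AddCommGroup G] : ℕ :=
  sInf {t : ℕ | 0 < t ∧ ∀ S : Multiset G, t ≤ Multiset.card S →
    ∃ S' ≤ S, S' ≠ 0 ∧ S'.sum = 0 ∧ Multiset.card S' ≤ AddMonoid.exponent G}

/-- `etaDD G d' d` : the smallest `t ≥ 1` such that every sequence over
    `G_d = {x : G | d • x = 0}` of length `≥ t` contains a non-empty subsequence of length
    at most `d'` whose sum lies in `G_{d/d'}`. -/
noncomputable def etaDD (G : Type*) [AddCommGroup G] (d' d : ℕ) : ℕ :=
  sInf {t : ℕ | 0 < t ∧ ∀ S : Multiset G, (∀ g ∈ S, d • g = 0) → t ≤ Multiset.card S →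
    ∃ S' ≤ S, S' ≠ 0 ∧ Multiset.card S' ≤ d' ∧ (d / d') • S'.sum = 0}

/-- `rhoC G` : the maximum of the cross numbers of sequences over `G` containing
    no tiny zero-sum subsequence. -/
noncomputable def rhoC (G : Type*) [AddCommGroup G] : ℝ :=
  sSup {x : ℝ | ∃ S : Multiset G, (¬ ∃ S' ≤ S, IsTinyZS S') ∧ crossNum S = x}

/-- `maxPF n = P⁺(n)`, the greatest prime divisor of `n`, with `P⁺(1) = 1`. -/
def maxPF (n : ℕ) : ℕ := if n = 1 then 1 else n.primeFactors.sup id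

/-- `G` is a finite abelian group of rank `r`, i.e. `G ≅ C_{n₁} ⊕ ⋯ ⊕ C_{n_r}` with
    `1 < n₁ ∣ ⋯ ∣ n_r`. -/
def HasRank (G : Type*) [AddCommGroup G] (r : ℕ) : Prop :=
  ∃ n : Fin r → ℕ, (∀ i, 1 < n i) ∧ (∀ i j : Fin r, i ≤ j → n i ∣ n j) ∧
    Nonempty (G ≃+ ((i : Fin r) → ZMod (n i)))

/-- `Reach S T`: the pebbles at the positions `T` can be obtained from those at `S` by discarding
pebbles and by replacing `p > 0` pebbles at `d` with a single pebble at `p * d`. -/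
inductive Reach (S : Multiset ℕ) : Multiset ℕ → Prop
  | refl : Reach S S
  | mono {T U : Multiset ℕ} : Reach S T → U ≤ T → Reach S U
  | step {p d : ℕ} {T : Multiset ℕ} :
      0 < p → Reach S (Multiset.replicate p d + T) → Reach S ((p * d) ::ₘ T)

namespace Reach

theorem trans {S T U : Multiset ℕ} (h : Reach S T) (h' : Reach T U) : Reach S U := by
  induction h' with
  | refl => exact h
  | mono _ hle ih => exact ih.mono hle
  | step hp _ ih => exact ih.step hp

theorem add_right {S T : Multiset ℕ} (h : Reach S T) (R : Multiset ℕ) :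
    Reach (S + R) (T + R) := by
  induction h with
  | refl => exact .refl
  | mono _ hle ih => exact ih.mono (add_le_add_left hle R)
  | step hp _ ih =>
    rw [Multiset.cons_add]
    exact .step hp (by rwa [add_assoc] at ih)

theorem add {S T S' T' : Multiset ℕ} (h : Reach S T) (h' : Reach S' T') :
    Reach (S + S') (T + T') := by
  refine (h.add_right S').trans ?_
  rw [add_comm T, add_comm T]
  exact h'.add_right T

theorem map_mul {S T : Multiset ℕ} (h : Reach S T) (c : ℕ) :
    Reach (S.map (c * ·)) (T.map (c * ·)) := by
  induction h with
  | refl => exact .refl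
  | mono _ hle ih => exact ih.mono (Multiset.map_le_map hle)
  | step hp _ ih =>
    rw [Multiset.map_cons, Nat.mul_left_comm]
    exact .step hp (by simpa using ih)

theorem replicate_mul {p : ℕ} (hp : 0 < p) (d : ℕ) :
    Reach (Multiset.replicate p d) {p * d} :=
  .step hp (by simpa using .refl)

end Reach

/-- Pebbles can be moved along the factor `p` as long as some position holds `p` of them. -/
theorem exists_reach_map_mul {p : ℕ} (hp : 0 < p) (c : ℕ) (S : Multiset ℕ)
    (h : p * c + (p - 1) * S.toFinset.card ≤ S.card) :
    ∃ E ≤ S, ∃ V : Multiset ℕ, V.card = c ∧ (∀ d ∈ V, d ∈ S) ∧ E.card = p * c ∧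
      Reach E (V.map (p * ·)) := by
  induction c generalizing S with
  | zero => exact ⟨0, by simp, 0, by simp, by simp, by simp, .refl⟩
  | succ c ih =>
    obtain ⟨d, hd, hcount⟩ : ∃ d ∈ S.toFinset, p - 1 < S.count d := by
      by_contra! hcon
      have h1 := Finset.sum_le_card_nsmul _ _ _ hcon
      rw [Multiset.toFinset_sum_count_eq, smul_eq_mul, mul_comm] at h1
      rw [mul_add] at h
      omega
    have hle : Multiset.replicate p d ≤ S :=
      Multiset.le_count_iff_replicate_le.1 (by omega)
    obtain ⟨R, rfl⟩ := Multiset.le_iff_exists_add.1 hle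
    have hq : R.toFinset.card ≤ (Multiset.replicate p d + R).toFinset.card :=
      Finset.card_le_card (Multiset.toFinset_subset.2 (Multiset.subset_of_le (by simp)))
    have hq' := Nat.mul_le_mul_left (p - 1) hq
    obtain ⟨E, hE, V, hV, hVR, hcard, hreach⟩ := ih R (by
      rw [Multiset.card_add, Multiset.card_replicate, mul_add] at h
      omega)
    refine ⟨Multiset.replicate p d + E, by gcongr, d ::ₘ V, by simp [hV], ?_, ?_, ?_⟩
    · intro x hx
      rcases Multiset.mem_cons.1 hx with rfl | hx
      · exact Multiset.mem_toFinset.1 hd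
      · exact Multiset.mem_add.2 (.inr (hVR x hx))
    · simp [hcard]; ring
    · rw [Multiset.map_cons, ← Multiset.singleton_add]
      exact (Reach.replicate_mul hp d).add hreach

/-- Any `n` pebbles on the divisors of `n` yield a pebble at `n`. -/
def OnePebbling (n : ℕ) : Prop :=
  ∀ S : Multiset ℕ, (∀ d ∈ S, d ∣ n) → n ≤ S.card → Reach S {n}

/-- More than `2 * n - q` pebbles on `q` distinct divisors of `n` yield two pebbles at `n`. -/
def TwoPebbling (n : ℕ) : Prop :=
  ∀ S : Multiset ℕ, (∀ d ∈ S, d ∣ n) → 2 * n < S.card + S.toFinset.card →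
    Reach S (Multiset.replicate 2 n)

theorem card_toFinset_le_of_dvd {n : ℕ} (hn : 0 < n) {S : Multiset ℕ} (hS : ∀ d ∈ S, d ∣ n) :
    S.toFinset.card ≤ n :=
  (Finset.card_le_card fun d hd => Nat.mem_divisors.2
    ⟨hS d (Multiset.mem_toFinset.1 hd), hn.ne'⟩).trans (Nat.card_divisors_le_self n)

theorem toFinset_sub_of_le_sub_dedup {S E : Multiset ℕ} (h : E ≤ S - S.dedup) :
    (S - E).toFinset = S.toFinset := by
  apply subset_antisymm
  · exact Multiset.toFinset_subset.2 (Multiset.subset_of_le (Multiset.sub_le_self _ _))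
  · intro x hx
    have hx' : x ∈ S.dedup := by simpa using hx
    have hle : S.dedup ≤ S - E := by
      have h1 := add_le_add_left h S.dedup
      rw [Multiset.sub_add_cancel (Multiset.dedup_le S)] at h1
      exact le_tsub_of_add_le_left h1
    exact Multiset.mem_toFinset.2 (Multiset.mem_of_le hle hx')

theorem card_sub_dedup_add (S : Multiset ℕ) :
    (S - S.dedup).card + S.toFinset.card = S.card := by
  rw [Multiset.card_toFinset, ← Multiset.card_add, Multiset.sub_add_cancel (Multiset.dedup_le S)]

theorem exists_le_card_eq {α : Type*} {S : Multiset α} {n : ℕ} (h : n ≤ S.card) :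
    ∃ E ≤ S, E.card = n := by
  have hpos : 0 < (S.powersetCard n).card := by
    rw [Multiset.card_powersetCard]
    exact Nat.choose_pos h
  obtain ⟨E, hE⟩ := Multiset.card_pos_iff_exists_mem.1 hpos
  exact ⟨E, Multiset.mem_powersetCard.1 hE⟩

theorem TwoPebbling.replicate {n : ℕ} (hn : 0 < n) (h1 : OnePebbling n) (h2 : TwoPebbling n)
    {k : ℕ} (hk : 2 ≤ k) (S : Multiset ℕ) (hS : ∀ d ∈ S, d ∣ n)
    (h : k * n < S.card + S.toFinset.card) : Reach S (Multiset.replicate k n) := by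
  induction k, hk using Nat.le_induction generalizing S with
  | base => exact h2 S hS h
  | succ k hk ih =>
    have hq := card_toFinset_le_of_dvd hn hS
    have hkn : 2 * n ≤ k * n := Nat.mul_le_mul_right n hk
    have hcard := card_sub_dedup_add S
    rw [add_mul] at h
    obtain ⟨E, hE, hEc⟩ := exists_le_card_eq (S := S - S.dedup) (n := n) (by omega)
    have hES : E ≤ S := hE.trans (Multiset.sub_le_self _ _)
    have hc := Multiset.card_sub hES
    have hr := ih (S - E) (fun d hd => hS d (Multiset.mem_of_le (Multiset.sub_le_self _ _) hd))
      (by rw [toFinset_sub_of_le_sub_dedup hE]; omega)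
    have he := h1 E (fun d hd => hS d (Multiset.mem_of_le hES hd)) hEc.ge
    have := hr.add he
    rwa [Multiset.sub_add_cancel hES, add_comm, Multiset.singleton_add,
      ← Multiset.replicate_succ] at this

theorem two_mul_card_toFinset_le_of_odd {n : ℕ} (hn : Odd n) {S : Multiset ℕ}
    (hS : ∀ d ∈ S, d ∣ n) : 2 * S.toFinset.card ≤ n + 1 := by
  obtain ⟨M, rfl⟩ := hn
  have hsub : S.toFinset ⊆ (Finset.range (M + 1)).image fun j => 2 * j + 1 := by
    intro d hd
    have hdvd := hS d (Multiset.mem_toFinset.1 hd)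
    obtain ⟨j, rfl⟩ := Odd.of_dvd_nat ⟨M, rfl⟩ hdvd
    have := Nat.le_of_dvd (by omega) hdvd
    exact Finset.mem_image.2 ⟨j, Finset.mem_range.2 (by omega), rfl⟩
  have := (Finset.card_le_card hsub).trans Finset.card_image_le
  rw [Finset.card_range] at this
  omega

theorem exists_map_mul_eq {p m : ℕ} (hp : 0 < p) {B : Multiset ℕ}
    (hB : ∀ d ∈ B, p ∣ d ∧ d ∣ p * m) :
    ∃ C : Multiset ℕ, C.map (p * ·) = B ∧ ∀ d ∈ C, d ∣ m := by
  refine ⟨B.map (· / p), ?_, ?_⟩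
  · rw [Multiset.map_map]
    exact (Multiset.map_congr rfl fun d hd => Nat.mul_div_cancel' (hB d hd).1).trans B.map_id
  · intro d hd
    obtain ⟨e, he, rfl⟩ := Multiset.mem_map.1 hd
    obtain ⟨⟨c, rfl⟩, h⟩ := hB e he
    rw [Nat.mul_div_cancel_left _ hp]
    exact Nat.dvd_of_mul_dvd_mul_left hp h

theorem card_toFinset_map_mul {p : ℕ} (hp : 0 < p) (C : Multiset ℕ) :
    (C.map (p * ·)).toFinset.card = C.toFinset.card := by
  rw [Multiset.toFinset_map]
  exact Finset.card_image_of_injective _ (fun _ _ h => Nat.eq_of_mul_eq_mul_left hp h)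

/-- The pebbles on the divisors of `p * m = K * l` split into those at divisors of `l` and those
at `p` times a divisor of `m`. -/
theorem exists_add_map_mul {p m K l : ℕ} (hp : p.Prime) (hK : ∀ d, d ∣ K * l → ¬ p ∣ d → d ∣ l)
    (hn : p * m = K * l) {S : Multiset ℕ} (hS : ∀ d ∈ S, d ∣ p * m) :
    ∃ A C : Multiset ℕ, S = A + C.map (p * ·) ∧ (∀ d ∈ A, d ∣ l) ∧ (∀ d ∈ C, d ∣ m) ∧
      S.card = A.card + C.card ∧ S.toFinset.card ≤ A.toFinset.card + C.toFinset.card := by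
  obtain ⟨C, hC, hCm⟩ := exists_map_mul_eq (m := m) hp.pos (B := S.filter (p ∣ ·))
    fun d hd => ⟨(Multiset.mem_filter.1 hd).2, hS d (Multiset.mem_filter.1 hd).1⟩
  have hsplit : S = S.filter (¬ p ∣ ·) + C.map (p * ·) := by
    rw [hC, add_comm, Multiset.filter_add_not]
  refine ⟨S.filter (¬ p ∣ ·), C, hsplit, fun d hd => ?_, hCm, ?_, ?_⟩
  · obtain ⟨hd, hpd⟩ := Multiset.mem_filter.1 hd
    exact hK d (hn ▸ hS d hd) hpd
  · conv_lhs => rw [hsplit]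
    simp
  · conv_lhs => rw [hsplit]
    rw [Multiset.toFinset_add, ← card_toFinset_map_mul hp.pos C]
    exact Finset.card_union_le _ _

theorem OnePebbling.reach_of_map_mul {m : ℕ} (hm : OnePebbling m) (p : ℕ) {C : Multiset ℕ}
    (hC : ∀ d ∈ C, d ∣ m) (h : m ≤ C.card) : Reach (C.map (p * ·)) {p * m} := by
  simpa using (hm C hC h).map_mul p

theorem TwoPebbling.reach_mul {l K : ℕ} (hl : 0 < l) (hl1 : OnePebbling l) (hl2 : TwoPebbling l)
    (hK : 2 ≤ K) {A : Multiset ℕ} (hA : ∀ d ∈ A, d ∣ l)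
    (h : K * l < A.card + A.toFinset.card) : Reach A {K * l} :=
  (hl2.replicate hl hl1 hK A hA h).trans (Reach.replicate_mul (by omega) l)

theorem OnePebbling.prime_mul {p m K l : ℕ} (hp : p.Prime) (hK : 2 ≤ K) (hl : 0 < l)
    (hdvd : ∀ d, d ∣ K * l → ¬ p ∣ d → d ∣ l) (hlm : l ∣ m) (hn : p * m = K * l)
    (hm1 : OnePebbling m) (hl1 : OnePebbling l) (hl2 : TwoPebbling l) :
    OnePebbling (p * m) := by
  intro S hS hcard
  obtain ⟨A, C, rfl, hA, hC, hSc, -⟩ := exists_add_map_mul hp hdvd hn hS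
  rw [hSc] at hcard
  rcases lt_or_ge C.card A.toFinset.card with hlt | hge
  · have h := hl2.reach_mul hl hl1 hK hA (by omega)
    rw [← hn] at h
    exact .trans (.mono .refl (Multiset.le_add_right _ _)) h
  rcases le_or_gt m C.card with hmC | hmC
  · exact .trans (.mono .refl (Multiset.le_add_left _ _)) (hm1.reach_of_map_mul p hC hmC)
  obtain ⟨E, hE, V, hV, hVA, -, hEV⟩ := exists_reach_map_mul hp.pos (m - C.card) A (by
    obtain ⟨P, rfl⟩ : ∃ P, p = P + 1 := ⟨p - 1, by have := hp.pos; omega⟩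
    obtain ⟨r, rfl⟩ := Nat.exists_eq_add_of_lt hmC
    have h1 := Nat.mul_le_mul_left P hge
    rw [show C.card + r + 1 - C.card = r + 1 by omega, Nat.add_sub_cancel]
    nlinarith)
  have h := hm1.reach_of_map_mul p (C := V + C) (fun d hd => ?_) (by
    rw [Multiset.card_add, hV]
    omega)
  · rw [Multiset.map_add] at h
    exact .trans (.mono .refl (add_le_add_left hE _)) ((hEV.add_right _).trans h)
  · rcases Multiset.mem_add.1 hd with hd | hd
    · exact (hA d (hVA d hd)).trans hlm
    · exact hC d hd

theorem TwoPebbling.prime_mul {p m K l : ℕ} (hp : p.Prime) (hK : 2 ≤ K) (hl : Odd l) (hm : 0 < m)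
    (hdvd : ∀ d, d ∣ K * l → ¬ p ∣ d → d ∣ l) (hlm : l ∣ m) (hn : p * m = K * l)
    (hm1 : OnePebbling m) (hm2 : TwoPebbling m) (hl1 : OnePebbling l) (hl2 : TwoPebbling l) :
    TwoPebbling (p * m) := by
  intro S hS hcard
  obtain ⟨A, C, rfl, hA, hC, hSc, hSq⟩ := exists_add_map_mul hp hdvd hn hS
  rw [hSc] at hcard
  have hpm : 2 * m ≤ p * m := Nat.mul_le_mul_right m hp.two_le
  rcases le_or_gt m C.card with hmC | hmC
  · rcases lt_or_ge (K * l) (A.card + A.toFinset.card) with hA' | hA'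
    · have h := hl2.reach_mul hl.pos hl1 hK hA hA'
      rw [← hn] at h
      exact h.add (hm1.reach_of_map_mul p hC hmC)
    · have h := (hm2 C hC (by omega)).map_mul p
      rw [Multiset.map_replicate] at h
      exact .trans (.mono .refl (Multiset.le_add_left _ _)) h
  have hqA := two_mul_card_toFinset_le_of_odd hl hA
  have hqC := Multiset.toFinset_card_le C
  have hsub := card_sub_dedup_add A
  have hq : (A - A.dedup).toFinset.card ≤ A.toFinset.card :=
    Finset.card_le_card (Multiset.toFinset_subset.2
      (Multiset.subset_of_le (Multiset.sub_le_self _ _)))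
  have hlm' := Nat.le_of_dvd hm hlm
  have hp2 := hp.two_le
  have hl0 := hl.pos
  obtain ⟨r, hr⟩ := Nat.exists_eq_add_of_lt hmC
  have hr' : m - C.card = r + 1 := by omega
  obtain ⟨E, hE, V, hV, hVA, hEc, hEV⟩ :=
    exists_reach_map_mul hp.pos (m - C.card) (A - A.dedup) (by
      obtain ⟨P, rfl⟩ : ∃ P, p = P + 1 := ⟨p - 1, by omega⟩
      have h1 := Nat.mul_le_mul_left P hq
      have h2 : (P + 2) * (2 * A.toFinset.card) ≤ (P + 2) * (l + 1) := Nat.mul_le_mul_left _ hqA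
      have h3 : P * 1 ≤ P * l := Nat.mul_le_mul_left P hl0
      have h4 : (P + 1) * l ≤ (P + 1) * m := Nat.mul_le_mul_left _ hlm'
      have h5 : 1 * C.card ≤ P * C.card := Nat.mul_le_mul_right _ (by omega)
      have h6 : (P + 1) * m = (P + 1) * C.card + (P + 1) * (r + 1) := by rw [hr]; ring
      rw [hr', Nat.add_sub_cancel]
      nlinarith)
  have hsubA : A - A.dedup ≤ A := Multiset.sub_le_self _ _
  have hEA : E ≤ A := hE.trans hsubA
  have h := hm1.reach_of_map_mul p (C := V + C) (fun d hd => ?_) (by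
    rw [Multiset.card_add, hV]
    omega)
  · have h' := hl2.reach_mul hl0 hl1 hK (A := A - E)
      (fun d hd => hA d (Multiset.mem_of_le (Multiset.sub_le_self _ _) hd)) (by
        rw [toFinset_sub_of_le_sub_dedup hE, Multiset.card_sub hEA, hEc, hr', ← hn]
        have h6 : p * m = p * C.card + p * (r + 1) := by rw [hr]; ring
        have h7 : 2 * C.card ≤ p * C.card := Nat.mul_le_mul_right _ hp2
        omega)
    rw [← hn] at h'
    rw [Multiset.map_add] at h
    have := h'.add ((hEV.add_right _).trans h)
    rw [← add_assoc, Multiset.sub_add_cancel hEA] at this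
    exact this
  · rcases Multiset.mem_add.1 hd with hd | hd
    · exact (hA d (Multiset.mem_of_le hsubA (hVA d hd))).trans hlm
    · exact hC d hd

theorem onePebbling_one : OnePebbling 1 := by
  intro S hS hcard
  obtain ⟨d, hd⟩ := Multiset.card_pos_iff_exists_mem.1 hcard
  obtain rfl := Nat.dvd_one.1 (hS d hd)
  exact .mono .refl (Multiset.singleton_le.2 hd)

theorem twoPebbling_one : TwoPebbling 1 := by
  intro S hS hcard
  have hq := card_toFinset_le_of_dvd one_pos hS
  have hrep := Multiset.eq_replicate_card.2 fun d hd => Nat.dvd_one.1 (hS d hd)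
  rw [hrep]
  exact .mono .refl ((Multiset.replicate_le_replicate 1).2 (by omega))

/-- Chung's pebbling theorem for the lattice of divisors of `n`. -/
theorem onePebbling_and_twoPebbling (n : ℕ) (hn : 0 < n) : OnePebbling n ∧ TwoPebbling n := by
  induction n using Nat.strong_induction_on with
  | _ n ih =>
    rcases Nat.eq_or_lt_of_le (Nat.succ_le_of_lt hn) with rfl | h1
    · exact ⟨onePebbling_one, twoPebbling_one⟩
    have hp : n.minFac.Prime := Nat.minFac_prime (by omega)
    obtain ⟨k, l, hpl, hkl⟩ := Nat.exists_eq_pow_mul_and_not_dvd hn.ne' n.minFac hp.ne_one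
    obtain ⟨m, hm⟩ := Nat.minFac_dvd n
    generalize hpn : n.minFac = p at *
    have hp2 := hp.two_le
    have hk : k ≠ 0 := by
      rintro rfl
      rw [pow_zero, one_mul] at hkl
      exact hpl (hkl ▸ hm ▸ Dvd.intro _ rfl)
    obtain ⟨k, rfl⟩ := Nat.exists_eq_succ_of_ne_zero hk
    have hm_eq : m = p ^ k * l := by
      apply Nat.eq_of_mul_eq_mul_left hp.pos
      rw [← hm, hkl, Nat.succ_eq_add_one]
      ring
    have hm0 : 0 < m := Nat.pos_of_ne_zero (by rintro rfl; omega)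
    have hmn : m < n := by nlinarith
    have hlm : l ∣ m := ⟨p ^ k, by rw [hm_eq, mul_comm]⟩
    have hl0 : 0 < l := Nat.pos_of_dvd_of_pos hlm hm0
    have hl : Odd l := by
      by_contra hcon
      rw [Nat.not_odd_iff_even, even_iff_two_dvd] at hcon
      have h2 : n.minFac ≤ 2 :=
        Nat.minFac_le_of_dvd le_rfl (hcon.trans (hlm.trans ⟨p, by rw [hm, mul_comm]⟩))
      have : p = 2 := by omega
      exact hpl (this ▸ hcon)
    have hdvd : ∀ d, d ∣ p ^ (k + 1) * l → ¬ p ∣ d → d ∣ l := fun d hd hpd =>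
      (((Nat.Prime.coprime_iff_not_dvd hp).2 hpd).symm.pow_right _).dvd_of_dvd_mul_left hd
    have hK : 2 ≤ p ^ (k + 1) := hp2.trans (Nat.le_self_pow (by omega) p)
    obtain ⟨hm1, hm2⟩ := ih m hmn hm0
    obtain ⟨hl1, hl2⟩ := ih l ((Nat.le_of_dvd hm0 hlm).trans_lt hmn) hl0
    have hn' : p * m = p ^ (k + 1) * l := by rw [← hm, ← hkl]
    rw [hm]
    exact ⟨.prime_mul hp hK hl0 hdvd hlm hn' hm1 hl1 hl2,
      .prime_mul hp hK hl hm0 hdvd hlm hn' hm1 hm2 hl1 hl2⟩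

theorem exists_map_eq_of_le_map {α β : Type*} {f : α → β} {U : Multiset β} {M : Multiset α}
    (h : U ≤ M.map f) : ∃ N ≤ M, N.map f = U := by
  induction U using Multiset.induction generalizing M with
  | empty => exact ⟨0, by simp, by simp⟩
  | cons b U ih =>
    obtain ⟨a, ha, rfl⟩ := Multiset.mem_map.1 (Multiset.mem_of_le h (Multiset.mem_cons_self b U))
    obtain ⟨R, rfl⟩ := Multiset.exists_cons_of_mem ha
    rw [Multiset.map_cons, Multiset.cons_le_cons_iff] at h
    obtain ⟨N, hN, rfl⟩ := ih h
    exact ⟨a ::ₘ N, Multiset.cons_le_cons a hN, Multiset.map_cons f a N⟩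

/-- The Davenport constant of `ZMod p` is at most `p`. -/
theorem exists_le_dvd_sum_map {β : Type*} {p : ℕ} (hp : 0 < p) (f : β → ℤ) (M : Multiset β)
    (hM : M.card = p) : ∃ N ≤ M, N ≠ 0 ∧ (p : ℤ) ∣ (N.map f).sum := by
  induction M using Quotient.inductionOn with
  | _ L =>
    change L.length = p at hM
    have : NeZero p := ⟨hp.ne'⟩
    obtain ⟨i, hi, j, hj, hij, heq⟩ := Finset.exists_ne_map_eq_of_card_lt_of_maps_to
      (s := Finset.range (p + 1)) (t := (Finset.univ : Finset (ZMod p))) (by simp [ZMod.card])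
      (f := fun i => ((((L.take i).map f).sum : ℤ) : ZMod p)) (by simp [Set.MapsTo])
    wlog hlt : i < j generalizing i j
    · exact this j hj i hi hij.symm heq.symm (by omega)
    rw [Finset.mem_range] at hi hj
    refine ⟨((L.take j).drop i : List β), ?_, ?_, ?_⟩
    · exact Multiset.coe_le.2 ((List.drop_sublist _ _).trans (List.take_sublist _ _)).subperm
    · intro h0
      have := congrArg Multiset.card h0
      simp at this
      omega
    · have hsplit : ((L.take j).map f).sum =
          ((L.take i).map f).sum + (((L.take j).drop i).map f).sum := by
        rw [← List.sum_append, ← List.map_append]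
        congr 2
        conv_lhs => rw [← List.take_append_drop i (L.take j), List.take_take, min_eq_left hlt.le]
      rw [← ZMod.intCast_zmod_eq_zero_iff_dvd, Multiset.map_coe, Multiset.sum_coe]
      rw [hsplit] at heq
      push_cast at heq
      simpa using heq

/-- A pebble at `d` is carried by a family `I` with sum of the `a i` divisible by `d` and sum of
the weights `w i` at most `d`. -/
def Carries {ι : Type*} (a : ι → ℤ) (w : ι → ℕ) (d : ℕ) (I : Multiset ι) : Prop :=
  I ≠ 0 ∧ (d : ℤ) ∣ (I.map a).sum ∧ (I.map w).sum ≤ d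

theorem Carries.exists_mul {ι : Type*} {a : ι → ℤ} {w : ι → ℕ} {p d : ℕ} (hp : 0 < p)
    {M : Multiset (Multiset ι)} (hM : M.card = p) (h : ∀ I ∈ M, Carries a w d I) :
    ∃ I ≤ M.sum, Carries a w (p * d) I := by
  obtain ⟨N, hNM, hN0, hN⟩ := exists_le_dvd_sum_map hp (fun I => (I.map a).sum / (d : ℤ)) M hM
  have hle : N.sum ≤ M.sum := by
    obtain ⟨R, rfl⟩ := Multiset.le_iff_exists_add.1 hNM
    simp
  refine ⟨N.sum, hle, ?_, ?_, ?_⟩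
  · intro h0
    obtain ⟨I, hI⟩ := Multiset.exists_mem_of_ne_zero hN0
    exact (h I (Multiset.mem_of_le hNM hI)).1
      (Multiset.le_zero.1 (h0 ▸ Multiset.le_sum_of_mem hI))
  · have hsum : (N.sum.map a).sum = d * (N.map fun I => (I.map a).sum / (d : ℤ)).sum := by
      rw [← Multiset.sum_map_mul_left, ← Multiset.join, Multiset.map_join, Multiset.sum_join,
        Multiset.map_map]
      congr 1
      exact Multiset.map_congr rfl fun I hI =>
        (Int.mul_ediv_cancel' (h I (Multiset.mem_of_le hNM hI)).2.1).symm
    rw [hsum, Nat.cast_mul, mul_comm]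
    exact mul_dvd_mul_left _ hN
  · have hsum : (N.sum.map w).sum = (N.map fun I => (I.map w).sum).sum := by
      rw [← Multiset.join, Multiset.map_join, Multiset.sum_join, Multiset.map_map]
      rfl
    have := Multiset.sum_le_card_nsmul (N.map fun I => (I.map w).sum) d (by
      intro x hx
      obtain ⟨I, hI, rfl⟩ := Multiset.mem_map.1 hx
      exact (h I (Multiset.mem_of_le hNM hI)).2.2)
    rw [Multiset.card_map, smul_eq_mul] at this
    rw [hsum]
    exact this.trans (Nat.mul_le_mul_right d (hM ▸ Multiset.card_le_card hNM))

theorem Reach.exists_carries {ι : Type*} (a : ι → ℤ) (w : ι → ℕ) (X : Multiset ι)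
    (hw : ∀ i, (w i : ℤ) ∣ a i) {T : Multiset ℕ} (h : Reach (X.map w) T) :
    ∃ M : Multiset (ℕ × Multiset ι), M.map Prod.fst = T ∧ (M.map Prod.snd).sum ≤ X ∧
      ∀ b ∈ M, Carries a w b.1 b.2 := by
  induction h with
  | refl =>
    refine ⟨X.map fun i => (w i, {i}), by simp, by simp, ?_⟩
    intro b hb
    obtain ⟨i, -, rfl⟩ := Multiset.mem_map.1 hb
    simp [Carries, hw]
  | mono _ hle ih =>
    obtain ⟨M, rfl, hX, hM⟩ := ih
    obtain ⟨N, hN, rfl⟩ := exists_map_eq_of_le_map hle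
    refine ⟨N, rfl, le_trans ?_ hX, fun b hb => hM b (Multiset.mem_of_le hN hb)⟩
    obtain ⟨R, rfl⟩ := Multiset.le_iff_exists_add.1 hN
    simp
  | @step p d T hp _ ih =>
    obtain ⟨M, hMT, hX, hM⟩ := ih
    obtain ⟨N, hN, hNp⟩ := exists_map_eq_of_le_map (hMT ▸ Multiset.le_add_right _ T)
    obtain ⟨R, rfl⟩ := Multiset.le_iff_exists_add.1 hN
    rw [Multiset.map_add, hNp, add_right_inj] at hMT
    obtain ⟨I, hI, hc⟩ := Carries.exists_mul (a := a) (w := w) (d := d) hp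
      (M := N.map Prod.snd) (by
        rw [Multiset.card_map, ← Multiset.card_map Prod.fst, hNp, Multiset.card_replicate]) (by
        intro I hI
        obtain ⟨b, hb, rfl⟩ := Multiset.mem_map.1 hI
        have hbd : b.1 = d :=
          Multiset.eq_of_mem_replicate (hNp ▸ Multiset.mem_map_of_mem Prod.fst hb)
        exact hbd ▸ hM b (Multiset.mem_add.2 (.inl hb)))
    refine ⟨(p * d, I) ::ₘ R, by simp [hMT], ?_, ?_⟩
    · rw [Multiset.map_cons, Multiset.sum_cons]
      rw [Multiset.map_add, Multiset.sum_add] at hX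
      exact (add_le_add_left hI _).trans hX
    · intro b hb
      rcases Multiset.mem_cons.1 hb with rfl | hb
      · exact hc
      · exact hM b (Multiset.mem_add.2 (.inr hb))

/-- **Kleitman–Lemke.** For any integers `a 1, …, a n` there is a non-empty subset
`I ⊆ {1,…,n}` with `n ∣ ∑_{i ∈ I} a i` and `∑_{i ∈ I} gcd(a i, n) ≤ n`. -/
theorem stmt0 (n : ℕ) (hn : 0 < n) (a : Fin n → ℤ) :
    ∃ I : Finset (Fin n), I.Nonempty ∧ (n : ℤ) ∣ (∑ i ∈ I, a i) ∧
      (∑ i ∈ I, Int.gcd (a i) (n : ℤ)) ≤ n := by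
  have hreach := (onePebbling_and_twoPebbling n hn).1
    ((Finset.univ : Finset (Fin n)).val.map fun i => Int.gcd (a i) (n : ℤ))
    (by
      intro d hd
      obtain ⟨i, -, rfl⟩ := Multiset.mem_map.1 hd
      exact Int.natCast_dvd_natCast.1 (Int.gcd_dvd_right (a i) n))
    (by simp)
  obtain ⟨M, hMn, hM, hc⟩ := hreach.exists_carries a _ _ fun i => Int.gcd_dvd_left (a i) n
  obtain ⟨⟨d, I⟩, rfl, hd⟩ := Multiset.map_eq_singleton.1 hMn
  obtain rfl : d = n := hd
  obtain ⟨h0, hdvd, hle⟩ := hc (d, I) (Multiset.mem_singleton_self _)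
  have hI : I ≤ (Finset.univ : Finset (Fin d)).val := by simpa using hM
  refine ⟨⟨I, Multiset.nodup_of_le hI Finset.univ.nodup⟩, ?_, hdvd, hle⟩
  obtain ⟨i, hi⟩ := Multiset.exists_mem_of_ne_zero h0
  exact ⟨i, hi⟩
end

section
/- For every positive integer n, one has t(C_n) = n, where C_n is the cyclic group of order n; that is, every sequence of n elements of C_n contains a non-empty subsequence with sum zero and cross number at most 1, and n is the smallest integer with this property. -/
open Multiset Finset

namespace Pebbling

/-- A predicate `F` on pebble configurations is closed for the weighted digraph `E` if it is
inherited by smaller configurations and preserved by every move that trades `r` pebbles at `v`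
for one pebble at `w`, where `E v w r`. -/
structure Closed {V : Type} [DecidableEq V] (E : V → V → ℕ → Prop) (F : (V → ℕ) → Prop) :
    Prop where
  mono : ∀ c d, c ≤ d → F d → F c
  move : ∀ v w r c, E v w r → F (c + r • Pi.single v 1) → F (c + Pi.single w 1)

/-- From every configuration of `m` pebbles one pebble can be moved to `o`. -/
def Solvable {V : Type} [Fintype V] [DecidableEq V] (E : V → V → ℕ → Prop) (o : V) (m : ℕ) :
    Prop :=
  ∀ F, Closed E F → ∀ c, F c → m ≤ ∑ v, c v → F (Pi.single o 1)

/-- The number of vertices whose number of pebbles is not divisible by `r`. -/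
def resid {V : Type} [Fintype V] (r : ℕ) (c : V → ℕ) : ℕ := ∑ v, if r ∣ c v then 0 else 1

/-- The number of occupied vertices. -/
def occ {V : Type} [Fintype V] (c : V → ℕ) : ℕ := ∑ v, if c v = 0 then 0 else 1

/-- The `r`-pebbling property, counting vertices with a non-multiple of `r` pebbles. -/
def ResidSolvable {V : Type} [Fintype V] [DecidableEq V] (E : V → V → ℕ → Prop) (o : V)
    (m r : ℕ) : Prop :=
  ∀ F, Closed E F → ∀ c, F c → r * m + 1 ≤ ∑ v, c v + resid r c → F (Pi.single o r)

/-- The `r`-pebbling property, counting occupied vertices. -/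
def OccSolvable {V : Type} [Fintype V] [DecidableEq V] (E : V → V → ℕ → Prop) (o : V)
    (m r : ℕ) : Prop :=
  ∀ F, Closed E F → ∀ c, F c → r * m + 1 ≤ ∑ v, c v + occ c → F (Pi.single o r)

/-- The product of the digraph `E` with an edge of weight `r`. -/
inductive Layered {V : Type} (E : V → V → ℕ → Prop) (r : ℕ) : V ⊕ V → V ⊕ V → ℕ → Prop
  | low {v w s} : E v w s → Layered E r (.inl v) (.inl w) s
  | high {v w s} : E v w s → Layered E r (.inr v) (.inr w) s
  | down (v) : Layered E r (.inr v) (.inl v) r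

section
variable {V : Type} [Fintype V]

lemma occ_le_card (c : V → ℕ) : occ c ≤ Fintype.card V := by
  unfold occ
  calc _ ≤ ∑ _v : V, 1 := Finset.sum_le_sum fun v _ => by split_ifs <;> simp
    _ = _ := by simp

lemma occ_le_sum (c : V → ℕ) : occ c ≤ ∑ v, c v :=
  Finset.sum_le_sum fun v _ => by split_ifs <;> omega

lemma resid_le_occ (r : ℕ) (c : V → ℕ) : resid r c ≤ occ c :=
  Finset.sum_le_sum fun v _ => by
    by_cases h : c v = 0
    · simp [h]
    · simp only [h, if_false]; split_ifs <;> simp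

lemma occ_elim (c d : V → ℕ) : occ (Sum.elim c d) = occ c + occ d :=
  Fintype.sum_sum_type _

lemma resid_elim (r : ℕ) (c d : V → ℕ) :
    resid r (Sum.elim c d) = resid r c + resid r d :=
  Fintype.sum_sum_type _

lemma occ_mono {c d : V → ℕ} (h : c ≤ d) : occ c ≤ occ d :=
  Finset.sum_le_sum fun v _ => by
    have : c v ≤ d v := h v
    split_ifs <;> omega

lemma sum_le_div_add_resid {r : ℕ} (hr : 0 < r) (c : V → ℕ) :
    ∑ v, c v ≤ r * ∑ v, c v / r + (r - 1) * resid r c := by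
  unfold resid
  rw [Finset.mul_sum, Finset.mul_sum, ← Finset.sum_add_distrib]
  refine Finset.sum_le_sum fun v _ => ?_
  have h1 := Nat.div_add_mod (c v) r
  have h2 := Nat.mod_lt (c v) hr
  split_ifs with h
  · rw [Nat.mul_div_cancel' h]; simp
  · simp only [mul_one]; omega

lemma exists_between [DecidableEq V] {l c : V → ℕ} (h : l ≤ c) {a : ℕ} (ha : ∑ v, l v ≤ a)
    (hc : a ≤ ∑ v, c v) : ∃ e, l ≤ e ∧ e ≤ c ∧ ∑ v, e v = a := by
  induction a, ha using Nat.le_induction with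
  | base => exact ⟨l, le_rfl, h, rfl⟩
  | succ a _ ih =>
    obtain ⟨e, h1, h2, h3⟩ := ih (by omega)
    have : ∃ v, e v < c v := by
      by_contra! hcon
      have := Finset.sum_le_sum fun v (_ : v ∈ Finset.univ) => hcon v
      omega
    obtain ⟨v, hv⟩ := this
    refine ⟨e + Pi.single v 1, h1.trans (by simp), fun w => ?_, ?_⟩
    · by_cases hw : w = v
      · subst hw; simpa using hv
      · simpa [hw] using h2 w
    · simp [Finset.sum_add_distrib, h3]

lemma exists_smul_le [DecidableEq V] (r : ℕ) (c : V → ℕ) {t : ℕ} (ht : t ≤ ∑ v, c v / r) :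
    ∃ s : V → ℕ, ∑ v, s v = t ∧ r • s ≤ c := by
  obtain ⟨s, -, h2, h3⟩ := exists_between (l := 0) (c := fun v => c v / r) (fun v => by simp)
    (by simp) ht
  refine ⟨s, h3, fun v => ?_⟩
  have := h2 v
  calc r * s v ≤ r * (c v / r) := Nat.mul_le_mul_left _ this
    _ ≤ c v := Nat.mul_div_le _ _

lemma sum_sub {c d : V → ℕ} (h : d ≤ c) : ∑ v, (c - d) v + ∑ v, d v = ∑ v, c v := by
  rw [← Finset.sum_add_distrib]
  exact Finset.sum_congr rfl fun v _ => Nat.sub_add_cancel (h v)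

variable [DecidableEq V] {E : V → V → ℕ → Prop} {o : V} {m r : ℕ}

omit [Fintype V] in
lemma Closed.frame {F : (V → ℕ) → Prop} (hF : Closed E F) (d : V → ℕ) :
    Closed E fun c => F (c + d) where
  mono c c' h h' := hF.mono _ _ (add_le_add_left h d) h'
  move v w r c h h' := by
    have := hF.move v w r (c + d) h (by rwa [add_right_comm])
    rwa [add_right_comm] at this

lemma Solvable.extract (hA : Solvable E o m) (k : ℕ) {F : (V → ℕ) → Prop} (hF : Closed E F)
    (c d : V → ℕ) (h : F (c + d)) (hk : k * m ≤ ∑ v, c v) : F (Pi.single o k + d) := by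
  induction k generalizing c d with
  | zero => exact hF.mono _ _ (by simp) h
  | succ k ih =>
    obtain ⟨e, -, h2, h3⟩ := exists_between (l := 0) (c := c) (fun v => by simp) (a := m)
      (by simp) (by nlinarith)
    have hs := sum_sub h2
    have h4 := hA _ (hF.frame (c - e + d)) e
      (by rwa [← add_assoc, add_tsub_cancel_of_le h2]) h3.ge
    have h5 := ih (c - e) (Pi.single o 1 + d)
      (by rwa [add_left_comm] at h4) (by rw [add_one_mul] at hk; omega)
    rwa [← add_assoc, ← Pi.single_add] at h5

lemma OccSolvable.of_three_le (hA : Solvable E o m) (hB : OccSolvable E o m 3)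
    (hm : Fintype.card V ≤ m) (hr : 3 ≤ r) : OccSolvable E o m r := by
  intro F hF c hc h
  have hq := (occ_le_card c).trans hm
  obtain ⟨k, rfl⟩ := Nat.exists_eq_add_of_le hr
  rw [add_mul] at h
  obtain ⟨e, h1, h2, h3⟩ := exists_between (l := fun v => if c v = 0 then 0 else 1) (c := c)
    (fun v => by dsimp only; split_ifs <;> omega) (a := ∑ v, c v - k * m)
    (by change occ c ≤ _; omega) (by omega)
  have hs := sum_sub h2
  have hoc : occ c ≤ occ e := by
    refine le_trans (le_of_eq ?_) (occ_mono h1)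
    unfold occ
    refine Finset.sum_congr rfl fun v _ => ?_
    split_ifs <;> simp_all
  have h4 := hA.extract k hF (c - e) e (by rwa [tsub_add_cancel_of_le h2]) (by omega)
  have h5 := hB _ (hF.frame (Pi.single o k)) e (by rwa [add_comm]) (by omega)
  rwa [← Pi.single_add] at h5

lemma OccSolvable.residSolvable (hB : OccSolvable E o m r) : ResidSolvable E o m r :=
  fun F hF c hc h => hB F hF c hc (h.trans (by have := resid_le_occ r c; omega))

section Layers

variable {F : (V ⊕ V → ℕ) → Prop} (hF : Closed (Layered E r) F)
include hF

omit [Fintype V] in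
lemma closed_low (d : V → ℕ) : Closed E fun c => F (Sum.elim c d) where
  mono c c' h h' := hF.mono _ _ (by rintro (v | v) <;> simp [h v]) h'
  move v w s c h h' := by
    have := hF.move _ _ _ (Sum.elim c d) (.low h) (by
      convert h' using 1; ext (u | u) <;> simp [Pi.single_apply])
    convert this using 1; ext (u | u) <;> simp [Pi.single_apply]

omit [Fintype V] in
lemma closed_high (d : V → ℕ) : Closed E fun c => F (Sum.elim d c) where
  mono c c' h h' := hF.mono _ _ (by rintro (v | v) <;> simp [h v]) h'
  move v w s c h h' := by
    have := hF.move _ _ _ (Sum.elim d c) (.high h) (by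
      convert h' using 1; ext (u | u) <;> simp [Pi.single_apply])
    convert this using 1; ext (u | u) <;> simp [Pi.single_apply]

lemma move_down (s c d : V → ℕ) (h : F (Sum.elim c (d + r • s))) : F (Sum.elim (c + s) d) := by
  induction hn : ∑ v, s v generalizing s c with
  | zero =>
    have : s = 0 := by ext v; simpa using (Finset.sum_eq_zero_iff.1 hn) v
    simpa [this] using h
  | succ n ih =>
    obtain ⟨v, -, hv⟩ := Finset.exists_ne_zero_of_sum_ne_zero (s := Finset.univ) (f := s)
      (by omega)
    have hle : Pi.single v 1 ≤ s := by
      intro w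
      by_cases hw : w = v
      · subst hw; simp; omega
      · simp [hw]
    obtain ⟨t, rfl⟩ : ∃ t, s = t + Pi.single v 1 := ⟨s - Pi.single v 1, by
      rw [tsub_add_cancel_of_le hle]⟩
    have h1 := hF.move _ _ _ (Sum.elim c (d + r • t)) (.down v) (by
      convert h using 1; ext (u | u) <;> simp [Pi.single_apply]; ring)
    have h2 := ih t (c + Pi.single v 1) (by
      convert h1 using 1; ext (u | u) <;> simp [Pi.single_apply])
      (by simp [Finset.sum_add_distrib] at hn; omega)
    rwa [add_right_comm, add_assoc] at h2

lemma move_down_sub {s c d : V → ℕ} (hs : r • s ≤ d) (h : F (Sum.elim c d)) :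
    F (Sum.elim (c + s) (d - r • s)) :=
  move_down hF s c _ (by rwa [tsub_add_cancel_of_le hs])

lemma move_down_root (k : ℕ) (c : V → ℕ) (h : F (Sum.elim c (Pi.single o (r * k)))) :
    F (Sum.elim (c + Pi.single o k) 0) :=
  move_down hF _ c 0 (by
    convert h using 2; rw [zero_add, ← smul_eq_mul, Pi.single_smul])

end Layers

omit [Fintype V] [DecidableEq V] in
lemma exists_elim (c : V ⊕ V → ℕ) : ∃ c₀ c₁, c = Sum.elim c₀ c₁ :=
  ⟨c ∘ Sum.inl, c ∘ Sum.inr, (Sum.elim_comp_inl_inr c).symm⟩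

omit [Fintype V] in
lemma elim_single (o : V) (k : ℕ) :
    (Sum.elim (Pi.single o k) 0 : V ⊕ V → ℕ) = Pi.single (Sum.inl o) k := by
  ext (u | u) <;> simp [Pi.single_apply]

lemma Solvable.layered (hr : 0 < r) (hA : Solvable E o m) (hB : ResidSolvable E o m r) :
    Solvable (Layered E r) (Sum.inl o) (r * m) := by
  intro F hF c hc h
  obtain ⟨c₀, c₁, rfl⟩ := exists_elim c
  simp only [Fintype.sum_sum_type, Sum.elim_inl, Sum.elim_inr] at h
  rw [← elim_single]
  by_cases hx : ∑ v, c₀ v < resid r c₁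
  · have h1 := hB _ (closed_high hF c₀) c₁ hc (by omega)
    have h2 := move_down_root hF (o := o) 1 c₀ (by simpa using h1)
    exact (closed_low hF 0).mono _ _ (by simp) h2
  · obtain ⟨s, hs, hsc⟩ := exists_smul_le r c₁ le_rfl
    have h1 := move_down_sub hF hsc hc
    have h2 := hA _ (closed_low hF _) _ h1 (by
      have := sum_le_div_add_resid hr c₁
      simp only [Pi.add_apply, Finset.sum_add_distrib, hs]
      obtain ⟨k, rfl⟩ := Nat.exists_eq_add_of_le' hr
      simp only [Nat.add_sub_cancel] at this
      push Not at hx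
      have h5 := Nat.mul_le_mul_left k hx
      refine Nat.le_of_mul_le_mul_left ?_ hr
      nlinarith)
    exact hF.mono _ _ (by rintro (v | v) <;> simp) h2

lemma ResidSolvable.layered_two (hA : Solvable E o m) (hB : ResidSolvable E o m 2)
    (hm : Fintype.card V ≤ m) : ResidSolvable (Layered E 2) (Sum.inl o) (2 * m) 2 := by
  intro F hF c hc h
  obtain ⟨c₀, c₁, rfl⟩ := exists_elim c
  simp only [Fintype.sum_sum_type, Sum.elim_inl, Sum.elim_inr, resid_elim] at h
  rw [← elim_single]
  have hq0 := (resid_le_occ 2 c₀).trans (occ_le_sum c₀)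
  have hq1 := (resid_le_occ 2 c₁).trans ((occ_le_card c₁).trans hm)
  by_cases hx : m ≤ ∑ v, c₀ v
  · by_cases hx' : 2 * m + 1 ≤ ∑ v, c₀ v + resid 2 c₀
    · have h1 := hB _ (closed_low hF _) _ hc hx'
      exact hF.mono _ _ (by rintro (v | v) <;> simp) h1
    · have h1 := hB _ (closed_high hF c₀) c₁ hc (by omega)
      have h2 := move_down_root hF (o := o) 1 c₀ (by simpa using h1)
      have h3 := hA.extract 1 (closed_low hF _) _ _ h2 (by omega)
      rwa [← Pi.single_add] at h3
  · have h0 := sum_le_div_add_resid two_pos c₁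
    obtain ⟨s, hs, hsc⟩ := exists_smul_le 2 c₁ (t := m - ∑ v, c₀ v) (by omega)
    have h1 := move_down_sub hF hsc hc
    have hres : resid 2 (c₁ - 2 • s) = resid 2 c₁ := by
      unfold resid
      refine Finset.sum_congr rfl fun v _ => ?_
      have := hsc v
      simp only [Pi.smul_apply, smul_eq_mul, Pi.sub_apply] at this ⊢
      congr 1
      simp only [eq_iff_iff]
      omega
    have hsum := sum_sub hsc
    simp only [Pi.smul_apply, smul_eq_mul, ← Finset.mul_sum, hs] at hsum
    have h2 := hB _ (closed_high hF _) _ h1 (by rw [hres]; omega)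
    have h3 := move_down_root hF (o := o) 1 _ (by simpa using h2)
    have h4 := hA.extract 1 (closed_low hF _) _ _ h3
      (by simp only [Pi.add_apply, Finset.sum_add_distrib, hs]; omega)
    rwa [← Pi.single_add] at h4

lemma OccSolvable.layered_three (hr : 2 ≤ r) (hA : Solvable E o m) (hB : OccSolvable E o m 3)
    (hm : Fintype.card V ≤ m) : OccSolvable (Layered E r) (Sum.inl o) (r * m) 3 := by
  intro F hF c hc h
  obtain ⟨c₀, c₁, rfl⟩ := exists_elim c
  simp only [Fintype.sum_sum_type, Sum.elim_inl, Sum.elim_inr, occ_elim] at h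
  rw [← elim_single]
  have hB2 : OccSolvable E o m (r * 2) := hB.of_three_le hA hm (by omega)
  have hq0 := occ_le_sum c₀
  have hq1 := (occ_le_card c₁).trans hm
  by_cases hx : m ≤ ∑ v, c₀ v
  · by_cases hy : r * 2 * m + 1 ≤ ∑ v, c₁ v + occ c₁
    · have h1 := hB2 _ (closed_high hF c₀) c₁ hc hy
      have h2 := move_down_root hF 2 c₀ h1
      have h3 := hA.extract 1 (closed_low hF _) _ _ h2 (by omega)
      rwa [← Pi.single_add] at h3
    · have h0 := sum_le_div_add_resid (by omega : 0 < r) c₁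
      have h0' := resid_le_occ r c₁
      obtain ⟨s, hs, hsc⟩ := exists_smul_le r c₁ (t := 3 * m + 1 - (∑ v, c₀ v + occ c₀)) (by
        obtain ⟨k, rfl⟩ := Nat.exists_eq_add_of_le' (by omega : 1 ≤ r)
        simp only [Nat.add_sub_cancel] at h0
        have h5 := Nat.mul_le_mul_left k h0'
        have h6 := Nat.mul_le_mul_left k hq1
        have h7 : (k + 1) * m + 1 ≤ ∑ v, c₀ v + occ c₀ := by nlinarith
        rw [tsub_le_iff_right]
        by_contra! hcon
        have h8 := Nat.mul_le_mul_left (k + 1) hcon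
        have h9 := Nat.mul_le_mul_left k h7
        have hk : 1 ≤ k := by omega
        have h10 : k * 1 * m ≤ k * k * m := by gcongr
        nlinarith)
      have h1 := move_down_sub hF hsc hc
      have ho : occ c₀ ≤ occ (c₀ + s) := occ_mono (by simp)
      have h2 := hB _ (closed_low hF _) _ h1
        (by simp only [Pi.add_apply, Finset.sum_add_distrib, hs]; omega)
      exact hF.mono _ _ (by rintro (v | v) <;> simp) h2
  · set l : V → ℕ := fun v => if c₁ v = 0 then 0 else 1 with hl
    have hlc : l ≤ c₁ := fun v => by simp only [hl]; split_ifs <;> omega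
    have hls := sum_sub hlc
    have hls' : ∑ v, l v = occ c₁ := rfl
    have h0 := sum_le_div_add_resid (by omega : 0 < r) (c₁ - l)
    have h0' : resid r (c₁ - l) ≤ occ c₁ := (resid_le_occ _ _).trans (occ_mono (by simp))
    obtain ⟨s, hs, hsc⟩ := exists_smul_le r (c₁ - l) (t := m - ∑ v, c₀ v) (by
      obtain ⟨k, rfl⟩ := Nat.exists_eq_add_of_le' (by omega : 1 ≤ r)
      simp only [Nat.add_sub_cancel] at h0
      have h5 := Nat.mul_le_mul_left k h0'
      have h6 := Nat.mul_le_mul_left k hq1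
      have hk : 1 ≤ k := by omega
      rw [tsub_le_iff_right]
      by_contra! hcon
      have h8 := Nat.mul_le_mul_left (k + 1) hcon
      have h10 : 1 * m ≤ k * m := by gcongr
      have h11 : 1 * (∑ v, c₀ v) ≤ k * (∑ v, c₀ v) := by gcongr
      nlinarith)
    have hsc' : r • s ≤ c₁ := hsc.trans (by simp)
    have h1 := move_down_sub hF hsc' hc
    have hoc : occ c₁ ≤ occ (c₁ - r • s) := by
      refine Finset.sum_le_sum fun v _ => ?_
      have := hsc v
      have := hlc v
      simp only [hl, Pi.sub_apply] at *
      split_ifs at * <;> omega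
    have hsum := sum_sub hsc'
    simp only [Pi.smul_apply, smul_eq_mul, ← Finset.mul_sum, hs] at hsum
    have h2 := hB2 _ (closed_high hF _) _ h1 (by
      obtain ⟨t, ht⟩ := Nat.exists_eq_add_of_le (le_of_not_ge hx)
      have : m - ∑ v, c₀ v = t := by omega
      rw [this] at hsum
      have h11 : 2 * (∑ v, c₀ v) ≤ r * (∑ v, c₀ v) := by gcongr
      have h12 : r * m = r * (∑ v, c₀ v) + r * t := by rw [← mul_add, ← ht]
      nlinarith)
    have h3 := move_down_root hF 2 _ h2
    have h4 := hA.extract 1 (closed_low hF _) _ _ h3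
      (by simp only [Pi.add_apply, Finset.sum_add_distrib, hs]; omega)
    rwa [← Pi.single_add] at h4

end

/-- A pebbling digraph on a cover of the divisors of `n`, with edges from `r * d` to `d`
of weight `r`, in which `n` pebbles always suffice to reach the divisor `1`. -/
structure DivisorModel (n : ℕ) where
  V : Type
  [fintype : Fintype V]
  [decEq : DecidableEq V]
  E : V → V → ℕ → Prop
  o : V
  val : V → ℕ
  card_le : Fintype.card V ≤ n
  solvable : Solvable E o n
  occSolvable : OccSolvable E o n 3
  val_root : val o = 1
  val_edge : ∀ v w r, E v w r → 0 < r ∧ val v = r * val w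
  exists_val : ∀ d, d ∣ n → ∃ v, val v = d

attribute [instance] DivisorModel.fintype DivisorModel.decEq

/-- Multiply a divisor model by a prime `p` using the `p`-pebbling property. -/
def DivisorModel.mul {n : ℕ} (M : DivisorModel n) {p : ℕ} (hp : p.Prime)
    (hB : ResidSolvable M.E M.o n p) : DivisorModel (p * n) where
  V := M.V ⊕ M.V
  E := Layered M.E p
  o := Sum.inl M.o
  val := Sum.elim M.val fun v => p * M.val v
  card_le := by
    have := M.card_le
    have := hp.two_le
    rw [Fintype.card_sum]
    nlinarith
  solvable := M.solvable.layered hp.pos hB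
  occSolvable := M.occSolvable.layered_three hp.two_le M.solvable M.card_le
  val_root := M.val_root
  val_edge := by
    rintro _ _ _ (h | h | _)
    · exact M.val_edge _ _ _ h
    · have := M.val_edge _ _ _ h
      refine ⟨this.1, ?_⟩
      simp only [Sum.elim_inr, this.2]
      ring
    · exact ⟨hp.pos, rfl⟩
  exists_val := by
    intro d hd
    obtain ⟨a, b, ha, hb, rfl⟩ := (Nat.dvd_mul).1 hd
    obtain ⟨v, hv⟩ := M.exists_val b hb
    rcases (Nat.dvd_prime hp).1 ha with rfl | rfl
    · exact ⟨Sum.inl v, by simp [hv]⟩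
    · exact ⟨Sum.inr v, by simp [hv]⟩

lemma exists_divisorModel_two_pow (j : ℕ) :
    ∃ M : DivisorModel (2 ^ j), ResidSolvable M.E M.o (2 ^ j) 2 := by
  induction j with
  | zero =>
    refine ⟨{ V := Unit, E := fun _ _ _ => False, o := (), val := fun _ => 1, card_le := by simp
              solvable := ?_, occSolvable := ?_, val_root := rfl, val_edge := by simp
              exists_val := by simp }, ?_⟩
    · intro F hF c hc h
      exact hF.mono _ _ (fun v => by simpa using h) hc
    · intro F hF c hc h
      refine hF.mono _ _ (fun v => ?_) hc
      simp only [occ, Finset.univ_unique, Finset.sum_singleton] at h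
      simp only [Pi.single_eq_same]
      change 3 ≤ c ()
      change 3 * 2 ^ 0 + 1 ≤ c () + ite (c () = 0) 0 1 at h
      split_ifs at h <;> omega
    · intro F hF c hc h
      refine hF.mono _ _ (fun v => ?_) hc
      simp only [resid, Finset.univ_unique, Finset.sum_singleton] at h
      simp only [Pi.single_eq_same]
      change 2 ≤ c ()
      change 2 * 2 ^ 0 + 1 ≤ c () + ite (2 ∣ c ()) 0 1 at h
      split_ifs at h <;> omega
  | succ j ih =>
    obtain ⟨M, hM⟩ := ih
    rw [pow_succ']
    exact ⟨M.mul Nat.prime_two hM, hM.layered_two M.solvable M.card_le⟩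

lemma nonempty_divisorModel {n : ℕ} (hn : 0 < n) : Nonempty (DivisorModel n) := by
  obtain ⟨j, a, ha, rfl⟩ := Nat.exists_eq_two_pow_mul_odd hn.ne'
  clear hn
  induction a using induction_on_primes with
  | zero => simp at ha
  | one => simpa using ⟨(exists_divisorModel_two_pow j).choose⟩
  | prime_mul p a hp ih =>
    rw [Nat.odd_mul] at ha
    obtain ⟨M⟩ := ih ha.2
    have h3 : 3 ≤ p := by
      have := hp.two_le
      rcases this.eq_or_lt with rfl | h
      · exact absurd ha.1 (by decide)
      · exact h
    rw [mul_left_comm]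
    exact ⟨M.mul hp (M.occSolvable.of_three_le M.solvable M.card_le h3).residSolvable⟩

end Pebbling

section ZeroSum

variable {n : ℕ}

lemma exists_sublist_sum_eq_zero {G : Type*} [AddCommGroup G] (H : Finset G) (L : List G)
    (hH : ∀ i, (L.take i).sum ∈ H) (hL : H.card ≤ L.length) :
    ∃ M, M.Sublist L ∧ M ≠ [] ∧ M.sum = 0 := by
  obtain ⟨i, hi, j, hj, hij, he⟩ := Finset.exists_ne_map_eq_of_card_lt_of_maps_to
    (s := Finset.range (L.length + 1)) (t := H) (f := fun i => (L.take i).sum)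
    (by simp; omega) (fun i _ => hH i)
  wlog hlt : i < j generalizing i j
  · exact this j hj i hi hij.symm he.symm (by omega)
  simp only [Finset.mem_range] at hj
  refine ⟨(L.take j).drop i, (List.drop_sublist _ _).trans (List.take_sublist _ _), ?_, ?_⟩
  · rw [← List.length_pos_iff]
    simp; omega
  · have h := List.sum_take_add_sum_drop (L.take j) i
    rw [List.take_take, min_eq_left hlt.le] at h
    rw [he] at h
    simpa using h

lemma exists_le_nsmul_sum_eq_zero [NeZero n] {ι : Type*} (Q : Multiset ι) (f : ι → ZMod n)
    (r d : ℕ) (hr : 0 < r) (hf : ∀ q ∈ Q, (r * d) • f q = 0) (hQ : Multiset.card Q = r) :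
    ∃ Q' ≤ Q, Q' ≠ 0 ∧ d • (Q'.map f).sum = 0 := by
  classical
  induction Q using Quotient.inductionOn with | h L =>
  have hsum (M : List ι) : (M.map fun q => d • f q).sum = d • (M.map f).sum := by
    induction M with
    | nil => simp
    | cons a M ih => simp only [List.map_cons, List.sum_cons, ih, smul_add]
  obtain ⟨M, h1, h2, h3⟩ := exists_sublist_sum_eq_zero
    (Finset.univ.filter fun x : ZMod n => r • x = 0) (L.map fun q => d • f q)
    (fun i => by
      simp only [Finset.mem_filter, Finset.mem_univ, true_and, ← List.map_take]
      have hM (M : List ι) (hM : ∀ q ∈ M, (r * d) • f q = 0) :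
          r • (M.map fun q => d • f q).sum = 0 := by
        induction M with
        | nil => simp
        | cons a M ih =>
          simp only [List.map_cons, List.sum_cons, smul_add]
          rw [ih fun q hq => hM q (by simp [hq]), smul_smul, hM a (by simp), add_zero]
      exact hM _ fun q hq => hf q (by simpa using List.mem_of_mem_take hq))
    ((IsAddCyclic.card_nsmul_eq_zero_le hr).trans (by simpa using hQ.ge))
  obtain ⟨N, hN, rfl⟩ := List.sublist_map_iff.1 h1
  refine ⟨(N : Multiset ι), Multiset.coe_le.2 hN.subperm, ?_, ?_⟩
  · simpa using h2
  · rw [hsum] at h3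
    simpa using h3

/-- `T` is a nonempty sequence whose sum is killed by `d` and whose cross number is at most
`1 / d`. -/
def IsPebble (d : ℕ) (T : Multiset (ZMod n)) : Prop :=
  T ≠ 0 ∧ d • T.sum = 0 ∧ d * crossNum T ≤ 1

/-- The sequence `S` contains disjoint pebbles, `c v` of them at each vertex `v`. -/
def Realizes {V : Type} [DecidableEq V] (val : V → ℕ) (S : Multiset (ZMod n)) (c : V → ℕ) :
    Prop :=
  ∃ Q : Multiset (V × Multiset (ZMod n)), (Q.map Prod.snd).sum ≤ S ∧
    (∀ v, c v ≤ (Q.map Prod.fst).count v) ∧ ∀ q ∈ Q, IsPebble (val q.1) q.2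

lemma exists_le_card_eq_s1 {ι : Type*} {Q : Multiset ι} {r : ℕ} (h : r ≤ Multiset.card Q) :
    ∃ R ≤ Q, Multiset.card R = r := by
  induction Q using Quotient.inductionOn with | h L =>
  exact ⟨(L.take r : Multiset ι), Multiset.coe_le.2 (List.take_sublist _ _).subperm,
    by simpa using h⟩

lemma crossNum_add {G : Type*} [AddCommGroup G] (S T : Multiset G) :
    crossNum (S + T) = crossNum S + crossNum T := by
  simp [crossNum]

lemma mul_crossNum_sum_le {ι : Type*} (Q : Multiset ι) (f : ι → Multiset (ZMod n)) (d : ℝ)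
    (h : ∀ q ∈ Q, d * crossNum (f q) ≤ 1) :
    d * crossNum (Q.map f).sum ≤ Multiset.card Q := by
  induction Q using Multiset.induction_on with
  | empty => simp [crossNum]
  | cons a Q ih =>
    have h1 := h a (by simp)
    have h2 := ih fun q hq => h q (by simp [hq])
    simp only [Multiset.map_cons, Multiset.sum_cons, crossNum_add, Multiset.card_cons]
    push_cast
    linarith

lemma sum_sum_map {ι : Type*} (Q : Multiset ι) (f : ι → Multiset (ZMod n)) :
    ((Q.map f).sum).sum = (Q.map fun q => (f q).sum).sum := by
  induction Q using Multiset.induction_on with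
  | empty => simp
  | cons a Q ih => simp [ih]

lemma closed_realizes [NeZero n] {V : Type} [DecidableEq V] {E : V → V → ℕ → Prop}
    {val : V → ℕ} (hE : ∀ v w r, E v w r → 0 < r ∧ val v = r * val w)
    (S : Multiset (ZMod n)) : Pebbling.Closed E (Realizes val S) where
  mono c d h := by
    rintro ⟨Q, h1, h2, h3⟩
    exact ⟨Q, h1, fun v => (h v).trans (h2 v), h3⟩
  move v w r c hvw := by
    rintro ⟨Q, h1, h2, h3⟩
    obtain ⟨hr, hval⟩ := hE v w r hvw
    have hcard : r ≤ Multiset.card (Q.filter fun q => v = q.1) := by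
      have := h2 v
      rw [Multiset.count_map] at this
      simp at this
      omega
    obtain ⟨R, hR, hRr⟩ := exists_le_card_eq_s1 hcard
    have hRQ : R ≤ Q := hR.trans (Multiset.filter_le _ _)
    have hRv : ∀ q ∈ R, q.1 = v := fun q hq =>
      (Multiset.mem_filter.1 (Multiset.mem_of_le hR hq)).2.symm
    have hpeb : ∀ q ∈ R, IsPebble (r * val w) q.2 := fun q hq => by
      rw [← hval, ← hRv q hq]
      exact h3 q (Multiset.mem_of_le hRQ hq)
    obtain ⟨P, hPR, hP0, hP⟩ := exists_le_nsmul_sum_eq_zero R (fun q => q.2.sum) r (val w) hr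
      (fun q hq => (hpeb q hq).2.1) hRr
    obtain ⟨U, rfl⟩ := Multiset.le_iff_exists_add.1 hRQ
    obtain ⟨W, rfl⟩ := Multiset.le_iff_exists_add.1 hPR
    have hcr := mul_crossNum_sum_le P Prod.snd (r * val w) fun q hq => by
      exact_mod_cast (hpeb q (by simp [hq])).2.2
    refine ⟨(w, (P.map Prod.snd).sum) ::ₘ U, le_trans ?_ h1, fun u => ?_, ?_⟩
    · simp only [Multiset.map_cons, Multiset.sum_cons, Multiset.map_add, Multiset.sum_add]
      gcongr
      exact Multiset.le_add_right _ _
    · have h4 := h2 u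
      have h5 : (P + W).map Prod.fst = Multiset.replicate r v := by
        rw [Multiset.eq_replicate]
        refine ⟨by simpa using hRr, ?_⟩
        simp only [Multiset.mem_map]
        rintro _ ⟨q, hq, rfl⟩
        exact hRv q hq
      rw [Multiset.map_add, h5, Multiset.count_add, Multiset.count_replicate] at h4
      simp only [Pi.add_apply, Pi.smul_apply, Pi.single_apply, Multiset.map_cons,
        Multiset.count_cons] at h4 ⊢
      by_cases hu : u = v
      · simp [hu] at h4 ⊢; omega
      · simp [hu, Ne.symm hu] at h4 ⊢; omega
    · simp only [Multiset.mem_cons]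
      rintro q (rfl | hq)
      · refine ⟨fun h0 => ?_, ?_, ?_⟩
        · obtain ⟨q, hq⟩ := Multiset.exists_mem_of_ne_zero hP0
          refine (hpeb q (by simp [hq])).1 (Multiset.le_zero.1 ?_)
          rw [← h0]
          exact Multiset.single_le_sum (fun _ _ => Multiset.zero_le _) _
            (Multiset.mem_map_of_mem _ hq)
        · rw [sum_sum_map]
          exact hP
        · have h6 : (Multiset.card P : ℝ) ≤ r := by
            exact_mod_cast hRr ▸ Multiset.card_le_card hPR
          have h7 := hcr.trans h6
          rw [mul_assoc] at h7
          have hr' : (0 : ℝ) < r := by exact_mod_cast hr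
          exact le_of_mul_le_mul_left (by simpa using h7) hr'
      · exact h3 q (by simp [hq])

/-- Every sequence of `n` elements of `C_n` has a tiny zero-sum subsequence. -/
theorem exists_isTinyZS [NeZero n] (S : Multiset (ZMod n)) (hS : n ≤ Multiset.card S) :
    ∃ T ≤ S, IsTinyZS T := by
  obtain ⟨M⟩ := Pebbling.nonempty_divisorModel (NeZero.pos n)
  have hv (g : ZMod n) : ∃ v, M.val v = addOrderOf g :=
    M.exists_val _ (by simpa using addOrderOf_dvd_natCard g)
  choose v hv using hv
  have h := M.solvable _ (closed_realizes M.val_edge S)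
    (fun u => (S.map v).count u)
    ⟨S.map fun g => (v g, {g}), by simp, by simp, by
      simp only [Multiset.mem_map]
      rintro _ ⟨g, -, rfl⟩
      have := addOrderOf_pos g
      refine ⟨by simp, by rw [hv, Multiset.sum_singleton, addOrderOf_nsmul_eq_zero], ?_⟩
      simp only [crossNum, hv, Multiset.map_singleton, Multiset.sum_singleton]
      rw [mul_one_div_cancel (by positivity)]⟩
    (by rw [Multiset.sum_count_eq_card (fun _ _ => Finset.mem_univ _)]; simpa using hS)
  obtain ⟨Q, h1, h2, h3⟩ := h
  have h4 := h2 M.o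
  rw [Pi.single_eq_same, Multiset.one_le_count_iff_mem, Multiset.mem_map] at h4
  obtain ⟨q, hq, hqo⟩ := h4
  obtain ⟨h5, h6, h7⟩ := h3 q hq
  rw [hqo, M.val_root] at h6 h7
  exact ⟨q.2, (Multiset.single_le_sum (fun _ _ => Multiset.zero_le _) _
    (Multiset.mem_map_of_mem _ hq)).trans h1, h5, by simpa using h6, by simpa using h7⟩

end ZeroSum

/-- `t(C_n) = n` for every positive integer `n`. -/
theorem stmt1 (n : ℕ) (hn : 0 < n) : tC (ZMod n) = n := by
  have : NeZero n := ⟨hn.ne'⟩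
  refine le_antisymm (Nat.sInf_le ⟨hn, exists_isTinyZS⟩) ?_
  refine le_csInf ⟨n, hn, exists_isTinyZS⟩ ?_
  rintro t ⟨ht, h⟩
  by_contra! hlt
  obtain ⟨T, hT, h0, hs, -⟩ := h (Multiset.replicate t 1) (by simp)
  obtain ⟨k, hk, rfl⟩ := Multiset.le_replicate_iff.1 hT
  rw [Multiset.sum_replicate, nsmul_one, ZMod.natCast_eq_zero_iff] at hs
  have hk0 : k ≠ 0 := by rintro rfl; simp at h0
  have := Nat.le_of_dvd (Nat.pos_of_ne_zero hk0) hs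
  omega
end

section
/- Let G ≅ C_{n_1} ⊕ ⋯ ⊕ C_{n_r}, with 1 < n_1 ∣ ⋯ ∣ n_r, be a finite abelian group and let d', d be positive integers with d' ∣ d ∣ exp(G). For each i ∈ {1,…,r} set A_i = gcd(d', n_i), B_i = lcm(d, n_i)/lcm(d', n_i) and υ_i(d',d) = A_i / gcd(A_i, B_i). Then η_{(d',d)}(G) = η(C_{υ_1(d',d)} ⊕ ⋯ ⊕ C_{υ_r(d',d)}). -/
open Multiset Finset

theorem Multiset.exists_le_map_eq_of_le_map {α β : Type*} {f : α → β} {S : Multiset α}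
    {T : Multiset β} (h : T ≤ S.map f) : ∃ S' ≤ S, S'.map f = T := by
  induction S using Quotient.inductionOn with
  | h l =>
    induction T using Quotient.inductionOn with
    | h m =>
      obtain ⟨m', hperm, hsub⟩ := Multiset.coe_le.1 h
      obtain ⟨l', hl', rfl⟩ := List.sublist_map_iff.1 hsub
      exact ⟨(l' : Multiset α), Multiset.coe_le.2 hl'.subperm, Quotient.sound hperm⟩

theorem Multiset.smul_sum_eq_map_sum {G H : Type*} [AddCommGroup G] [AddCommGroup H]
    (ψ : H →+ G) (e : ℕ) (f : G → H) (S : Multiset G) (hf : ∀ g ∈ S, ψ (f g) = e • g) :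
    e • S.sum = ψ (S.map f).sum := by
  rw [map_multiset_sum, Multiset.map_map, Multiset.map_congr
    (f := ψ ∘ f) (g := fun g => e • g) rfl hf, Multiset.sum_map_nsmul,
    Multiset.map_id']

/-- If `(d / d') • G_d` is the image of an embedding of a group `H` of exponent `d'`,
then `η_{(d',d)}(G) = η(H)`. -/
theorem etaDD_eq_etaC_of_injective {G H : Type*} [AddCommGroup G] [AddCommGroup H]
    {d' d : ℕ} (ψ : H →+ G) (hψ : Function.Injective ψ)
    (hexp : AddMonoid.exponent H = d')
    (hrange : ∀ y : G, (∃ h, ψ h = y) ↔ ∃ x : G, d • x = 0 ∧ (d / d') • x = y) :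
    etaDD G d' d = etaC H := by
  unfold etaDD etaC
  congr 1
  ext t
  refine and_congr_right fun _ => ⟨fun hG T hT => ?_, fun hH S hS hcard => ?_⟩
  · choose x hxd hx using fun h => (hrange (ψ h)).1 ⟨h, rfl⟩
    obtain ⟨S', hS', hne, hc, hsum⟩ := hG (T.map x)
      (by simpa using fun h _ => hxd h) (by simpa using hT)
    obtain ⟨T', hT', rfl⟩ := Multiset.exists_le_map_eq_of_le_map hS'
    refine ⟨T', hT', fun h => hne (by simp [h]), hψ ?_, by simpa [hexp] using hc⟩
    rw [_root_.map_zero, ← hsum, map_multiset_sum, ← Multiset.sum_map_nsmul]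
    simp [hx]
  · have hex : ∀ g : G, ∃ h, d • g = 0 → ψ h = (d / d') • g := fun g => by
      by_cases hg : d • g = 0
      · obtain ⟨h, hh⟩ := (hrange ((d / d') • g)).2 ⟨g, hg, rfl⟩
        exact ⟨h, fun _ => hh⟩
      · exact ⟨0, fun h => absurd h hg⟩
    choose f hf using hex
    obtain ⟨T', hT', hne, hsum, hc⟩ := hH (S.map f) (by simpa using hcard)
    obtain ⟨S', hS', rfl⟩ := Multiset.exists_le_map_eq_of_le_map hT'
    refine ⟨S', hS', fun h => hne (by simp [h]), by simpa [hexp] using hc, ?_⟩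
    rw [Multiset.smul_sum_eq_map_sum ψ _ f S'
      fun g hg => hf g (hS g (Multiset.mem_of_le hS' hg)), hsum, _root_.map_zero]

theorem Nat.gcd_div_gcd_lcm_div_lcm_mul {n d' d : ℕ} (hn : 0 < n) (hd : 0 < d)
    (hd'd : d' ∣ d) :
    d'.gcd n / (d'.gcd n).gcd (d.lcm n / d'.lcm n) * (d / d').gcd n = d.gcd n := by
  obtain ⟨e, rfl⟩ := hd'd
  have hd' : 0 < d' := Nat.pos_of_mul_pos_right hd
  rw [Nat.mul_div_cancel_left _ hd']
  obtain ⟨B, hB⟩ : d'.lcm n ∣ (d' * e).lcm n :=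
    Nat.lcm_dvd_lcm_of_dvd_left n (dvd_mul_right d' e)
  have hL : 0 < d'.lcm n := Nat.lcm_pos hd' hn
  rw [hB, Nat.mul_div_cancel_left _ hL]
  have h1 := Nat.gcd_mul_lcm d' n
  have h2 := Nat.gcd_mul_lcm (d' * e) n
  have hA : 0 < d'.gcd n := Nat.gcd_pos_of_pos_left _ hd'
  set A := d'.gcd n
  set g := (d' * e).gcd n with hg
  have hBg : B * g = A * e := by
    apply Nat.eq_of_mul_eq_mul_left hL
    rw [hB] at h2
    calc d'.lcm n * (B * g) = g * (d'.lcm n * B) := by ring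
      _ = d' * n * e := by rw [h2]; ring
      _ = d'.lcm n * (A * e) := by rw [← h1]; ring
  have hge : g.gcd e = e.gcd n := by
    rw [hg, Nat.gcd_comm, ← Nat.gcd_assoc, Nat.gcd_mul_left_right]
  have hk : A.gcd B * g = A * e.gcd n := by
    rw [← Nat.gcd_mul_right, hBg, Nat.gcd_mul_left, hge]
  obtain ⟨u, hu⟩ := Nat.gcd_dvd_left A B
  have hc : 0 < A.gcd B := Nat.gcd_pos_of_pos_left _ hA
  have hdiv : A / A.gcd B = u := Nat.div_eq_of_eq_mul_right hc hu
  rw [hdiv]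
  apply Nat.eq_of_mul_eq_mul_left hc
  rw [hk, ← mul_assoc, ← hu]

/-- If `υ * gcd(e, n) = gcd(d, n)` with `e ∣ d`, then `e • (ZMod n)_d` is the image of an
embedding of `ZMod υ`. -/
theorem ZMod.exists_injective_range_eq_smul_torsion {n d e υ : ℕ} (hn : 0 < n)
    (hυ : υ * e.gcd n = d.gcd n) :
    ∃ ψ : ZMod υ →+ ZMod n, Function.Injective ψ ∧
      ∀ y, (∃ h, ψ h = y) ↔ ∃ x : ZMod n, d • x = 0 ∧ e • x = y := by
  have hυg : υ ∣ d.gcd n := ⟨_, hυ.symm⟩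
  obtain ⟨c, hc⟩ := Nat.gcd_dvd_right d n
  obtain ⟨m, hm⟩ : υ ∣ n := hυg.trans (Nat.gcd_dvd_right d n)
  have hm0 : 0 < m := Nat.pos_of_mul_pos_left (hm ▸ hn)
  have hυ0 : 0 < υ := Nat.pos_of_mul_pos_right (hm ▸ hn)
  have hmc : m = c * e.gcd n := by
    apply Nat.eq_of_mul_eq_mul_left hυ0
    rw [← hm]
    nth_rewrite 1 [hc]
    rw [← hυ]; ring
  have hnz : ((υ : ZMod n)) * (m : ZMod n) = 0 := by
    rw [← Nat.cast_mul, ← hm, ZMod.natCast_self]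
  let φ : {f : ℤ →+ ZMod n // f υ = 0} :=
    ⟨(AddMonoidHom.mulRight (m : ZMod n)).comp (Int.castAddHom (ZMod n)), by simpa using hnz⟩
  have hφ : ∀ k : ℤ, ZMod.lift υ φ (k : ZMod υ) = (k : ZMod n) * m := fun k => by
    rw [ZMod.lift_coe]; rfl
  refine ⟨ZMod.lift υ φ, (ZMod.lift_injective υ).2 fun k hk => ?_, fun y => ⟨?_, ?_⟩⟩
  · have hk' : (k : ZMod n) * m = 0 := hk
    have h : ((k * m : ℤ) : ZMod n) = 0 := by push_cast; exact hk'
    rw [ZMod.intCast_zmod_eq_zero_iff_dvd, hm] at h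
    rw [ZMod.intCast_zmod_eq_zero_iff_dvd]
    push_cast at h
    exact Int.dvd_of_mul_dvd_mul_right (by exact_mod_cast hm0.ne') h
  · rintro ⟨h, rfl⟩
    obtain ⟨k, rfl⟩ := ZMod.intCast_surjective h
    rw [hφ]
    have hbez := congrArg (Int.cast : ℤ → ZMod n) (Nat.gcd_eq_gcd_ab e n)
    push_cast at hbez
    rw [ZMod.natCast_self, zero_mul, add_zero] at hbez
    refine ⟨k * c * (e.gcdA n : ZMod n), ?_, ?_⟩
    · obtain ⟨q, hq⟩ := Nat.gcd_dvd_left d n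
      have hdc : (d : ZMod n) * c = 0 := by
        rw [← Nat.cast_mul, ZMod.natCast_eq_zero_iff]
        refine ⟨q, ?_⟩
        calc d * c = (d.gcd n * q) * c := by rw [← hq]
          _ = (d.gcd n * c) * q := by ring
          _ = n * q := by rw [← hc]
      rw [nsmul_eq_mul]
      linear_combination (k * (e.gcdA n : ZMod n)) * hdc
    · rw [nsmul_eq_mul, hmc]
      push_cast
      linear_combination (-(k * c : ZMod n)) * hbez
  · rintro ⟨x, hx, rfl⟩
    obtain ⟨k, rfl⟩ := ZMod.intCast_surjective x
    obtain ⟨e', he'⟩ := Nat.gcd_dvd_left e n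
    have hg : d.gcd n • (k : ZMod n) = 0 := by
      rw [← addOrderOf_dvd_iff_nsmul_eq_zero] at hx ⊢
      refine Nat.dvd_gcd hx ?_
      rw [addOrderOf_dvd_iff_nsmul_eq_zero, nsmul_eq_mul, ZMod.natCast_self, zero_mul]
    have hυe : ((υ : ℤ) * m) ∣ υ * (e * k) := by
      have h1 : ((n : ℕ) : ℤ) ∣ d.gcd n * k := by
        rw [← ZMod.intCast_zmod_eq_zero_iff_dvd]
        push_cast
        rwa [nsmul_eq_mul] at hg
      have h2 : (υ : ℤ) * (e * k) = d.gcd n * k * e' := by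
        have : (υ : ℤ) * e = d.gcd n * e' := by
          rw [← hυ]; nth_rewrite 1 [he']; push_cast; ring
        linear_combination (k : ℤ) * this
      rw [h2, ← Nat.cast_mul, ← hm]
      exact h1.mul_right _
    obtain ⟨j, hj⟩ := Int.dvd_of_mul_dvd_mul_left (by exact_mod_cast hυ0.ne') hυe
    refine ⟨j, ?_⟩
    rw [hφ, nsmul_eq_mul]
    have := congrArg (Int.cast : ℤ → ZMod n) hj
    push_cast at this
    rw [this, mul_comm]

/-- `η_{(d',d)}(G) = η(C_{υ₁(d',d)} ⊕ ⋯ ⊕ C_{υ_r(d',d)})` where, for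
`G ≅ C_{n₁} ⊕ ⋯ ⊕ C_{n_r}` with `1 < n₁ ∣ ⋯ ∣ n_r`, one sets `A i = gcd(d', n i)`,
`B i = lcm(d, n i) / lcm(d', n i)` and `υ i = A i / gcd (A i) (B i)`. -/
theorem stmt4 (r : ℕ) (hr : 0 < r) (n : Fin r → ℕ) (hn1 : ∀ i, 1 < n i)
    (hchain : ∀ i j : Fin r, i ≤ j → n i ∣ n j)
    (G : Type*) [AddCommGroup G] [Fintype G]
    (hiso : Nonempty (G ≃+ ((i : Fin r) → ZMod (n i))))
    (d' d : ℕ) (hd' : 0 < d') (hd : 0 < d)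
    (hd'd : d' ∣ d) (hdexp : d ∣ AddMonoid.exponent G) :
    etaDD G d' d =
      etaC ((i : Fin r) → ZMod
        (Nat.gcd d' (n i) /
          Nat.gcd (Nat.gcd d' (n i)) (Nat.lcm d (n i) / Nat.lcm d' (n i)))) := by
  obtain ⟨φ⟩ := hiso
  set υ : Fin r → ℕ := fun i => Nat.gcd d' (n i) /
    Nat.gcd (Nat.gcd d' (n i)) (Nat.lcm d (n i) / Nat.lcm d' (n i))
  have hn0 : ∀ i, 0 < n i := fun i => Nat.zero_lt_of_lt (hn1 i)
  have hυ : ∀ i, υ i * (d / d').gcd (n i) = d.gcd (n i) := fun i =>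
    Nat.gcd_div_gcd_lcm_div_lcm_mul (hn0 i) hd hd'd
  choose ψ hψ hrange using fun i =>
    ZMod.exists_injective_range_eq_smul_torsion (hn0 i) (hυ i)
  let Ψ : ((i : Fin r) → ZMod (υ i)) →+ ((i : Fin r) → ZMod (n i)) :=
    AddMonoidHom.mk' (fun x i => ψ i (x i)) fun x y => by ext i; simp
  refine etaDD_eq_etaC_of_injective (φ.symm.toAddMonoidHom.comp Ψ) ?_ ?_ fun y => ⟨?_, ?_⟩
  · exact φ.symm.injective.comp fun x y hxy => funext fun i => hψ i (congrFun hxy i)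
  · rw [AddMonoid.exponent_pi]
    simp_rw [ZMod.exponent]
    refine Nat.dvd_antisymm (Finset.lcm_dvd fun i _ =>
      (Nat.div_dvd_of_dvd (Nat.gcd_dvd_left _ _)).trans (Nat.gcd_dvd_left _ _)) ?_
    let i₀ : Fin r := ⟨r - 1, by omega⟩
    have hdn : d ∣ n i₀ := by
      refine hdexp.trans ?_
      rw [AddMonoid.exponent_eq_of_addEquiv φ, AddMonoid.exponent_pi]
      simp_rw [ZMod.exponent]
      exact Finset.lcm_dvd fun i _ => hchain i i₀ (Fin.le_def.2 (by simp only [i₀]; omega))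
    have h := hυ i₀
    rw [Nat.gcd_eq_left hdn,
      Nat.gcd_eq_left ((Nat.div_dvd_of_dvd hd'd).trans hdn)] at h
    have he : 0 < d / d' := Nat.div_pos (Nat.le_of_dvd hd hd'd) hd'
    have h' : υ i₀ = d' :=
      Nat.eq_of_mul_eq_mul_right he (h.trans (Nat.mul_div_cancel' hd'd).symm)
    exact h'.symm.dvd.trans (Finset.dvd_lcm (Finset.mem_univ i₀))
  · rintro ⟨h, rfl⟩
    choose x hxd hx using fun i => (hrange i (ψ i (h i))).1 ⟨h i, rfl⟩
    refine ⟨φ.symm x, ?_, ?_⟩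
    · rw [← _root_.map_nsmul, show d • x = 0 from funext hxd, _root_.map_zero]
    · rw [← _root_.map_nsmul, show (d / d') • x = Ψ h from funext hx]
      rfl
  · rintro ⟨x, hxd, rfl⟩
    choose h hh using fun i => (hrange i ((d / d') • φ x i)).2 ⟨φ x i, by
      rw [← Pi.smul_apply, ← _root_.map_nsmul, hxd, _root_.map_zero, Pi.zero_apply], rfl⟩
    refine ⟨h, φ.injective ?_⟩
    rw [_root_.map_nsmul]
    exact (φ.apply_symm_apply _).trans (funext hh)
end

section
/- Fix r ∈ ℕ* and a real constant c > 0 such that η(C_m^r) ≤ c(m−1)+1 for every m ∈ ℕ*. Then for every finite abelian group G of rank r and all positive integers d', d with d' ∣ d ∣ exp(G), one has η_{(d',d)}(G) ≤ c(d'−1)+1. -/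
open Multiset Finset

/-- A submultiset of an image lifts to a submultiset of the original multiset. -/
theorem Multiset.exists_le_map_eq {α β : Type*} (f : α → β) {S : Multiset α} {T : Multiset β}
    (h : T ≤ S.map f) : ∃ S' ≤ S, S'.map f = T := by
  induction S using Quotient.inductionOn with
  | h l =>
    induction T using Quotient.inductionOn with
    | h l' =>
      obtain ⟨l₁, h₁, h₂⟩ := Multiset.coe_le.1 h
      obtain ⟨l₂, h₃, rfl⟩ := List.sublist_map_iff.1 h₂
      exact ⟨l₂, Multiset.coe_le.2 h₃.subperm, Multiset.coe_eq_coe.2 h₁⟩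

/-- For a finite group the infimum defining `etaC` is attained. -/
theorem etaC_spec (G : Type*) [AddCommGroup G] [Finite G] :
    0 < etaC G ∧ ∀ S : Multiset G, etaC G ≤ Multiset.card S →
      ∃ S' ≤ S, S' ≠ 0 ∧ S'.sum = 0 ∧ Multiset.card S' ≤ AddMonoid.exponent G := by
  classical
  have := Fintype.ofFinite G
  have hexp : 0 < AddMonoid.exponent G :=
    Nat.pos_of_ne_zero AddMonoid.exponent_ne_zero_of_finite
  refine Nat.sInf_mem (s := {t : ℕ | 0 < t ∧ ∀ S : Multiset G, t ≤ Multiset.card S →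
    ∃ S' ≤ S, S' ≠ 0 ∧ S'.sum = 0 ∧ Multiset.card S' ≤ AddMonoid.exponent G})
    ⟨Fintype.card G * AddMonoid.exponent G + 1, Nat.succ_pos _, fun S hS => ?_⟩
  obtain ⟨g, hg⟩ : ∃ g, AddMonoid.exponent G ≤ S.count g := by
    by_contra! hcount
    have hsum : ∑ g : G, S.count g = Multiset.card S :=
      Multiset.sum_count_eq_card fun _ _ => Finset.mem_univ _
    have hle : ∑ g : G, S.count g ≤ ∑ _g : G, AddMonoid.exponent G :=
      Finset.sum_le_sum fun g _ => (hcount g).le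
    rw [Finset.sum_const, Finset.card_univ, smul_eq_mul] at hle
    omega
  refine ⟨Multiset.replicate (AddMonoid.exponent G) g, Multiset.le_count_iff_replicate_le.1 hg,
    fun h => ?_, ?_, (Multiset.card_replicate _ _).le⟩
  · have := congrArg Multiset.card h
    rw [Multiset.card_replicate, Multiset.card_zero] at this
    omega
  · rw [Multiset.sum_replicate, AddMonoid.exponent_nsmul_eq_zero]

/-- If all elements of `S` lie in the `d' * e`-torsion of `ZMod n` and the integers
`d' * e * x / n` (`x ∈ S`) sum to a multiple of `d'`, then the sum of `S` is killed by `e`. -/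
theorem ZMod.nsmul_sum_eq_zero_of_sum_div_eq_zero {n d' e : ℕ} [NeZero n] (hd' : 0 < d')
    {S : Multiset (ZMod n)} (hS : ∀ x ∈ S, (d' * e) • x = 0)
    (hsum : (S.map fun x => ((d' * e * x.val / n : ℕ) : ZMod d')).sum = 0) :
    e • S.sum = 0 := by
  have hdvd : d' ∣ (S.map fun x => d' * e * x.val / n).sum := by
    rw [← ZMod.natCast_eq_zero_iff, Nat.cast_multiset_sum, Multiset.map_map]
    exact hsum
  have hmul : n * (S.map fun x => d' * e * x.val / n).sum
      = d' * (e * (S.map ZMod.val).sum) := by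
    rw [← Multiset.sum_map_mul_left, ← mul_assoc, ← Multiset.sum_map_mul_left]
    refine congrArg Multiset.sum (Multiset.map_congr rfl fun x hx => Nat.mul_div_cancel' ?_)
    rw [← ZMod.natCast_eq_zero_iff, Nat.cast_mul, ZMod.natCast_zmod_val, ← nsmul_eq_mul]
    exact hS x hx
  have hn : n ∣ e * (S.map ZMod.val).sum := by
    refine Nat.dvd_of_mul_dvd_mul_left hd' ?_
    rw [← hmul, mul_comm d' n]
    exact Nat.mul_dvd_mul_left n hdvd
  rw [← ZMod.natCast_eq_zero_iff, Nat.cast_mul, Nat.cast_multiset_sum, Multiset.map_map] at hn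
  simpa [nsmul_eq_mul] using hn

/-- The generalized constant `etaDD G d' d` is bounded by `η(C_{d'}^r)`. -/
theorem etaDD_le_etaC {G : Type*} [AddCommGroup G] {r : ℕ} (hG : HasRank G r)
    {d' d : ℕ} (hd' : 0 < d') (hd'd : d' ∣ d) :
    etaDD G d' d ≤ etaC (Fin r → ZMod d') := by
  obtain ⟨n, hn, -, ⟨φ⟩⟩ := hG
  obtain ⟨e, rfl⟩ := hd'd
  have : NeZero d' := ⟨hd'.ne'⟩
  have (i : Fin r) : NeZero (n i) := ⟨(zero_lt_one.trans (hn i)).ne'⟩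
  obtain ⟨hpos, hη⟩ := etaC_spec (Fin r → ZMod d')
  refine Nat.sInf_le ⟨hpos, fun S hS hcard => ?_⟩
  let f : G → Fin r → ZMod d' := fun x i => ((d' * e * (φ x i).val / n i : ℕ) : ZMod d')
  obtain ⟨T, hT, hT0, hTsum, hTcard⟩ := hη (S.map f) (by rwa [Multiset.card_map])
  obtain ⟨S', hS', rfl⟩ := Multiset.exists_le_map_eq f hT
  have hexp : AddMonoid.exponent (Fin r → ZMod d') ∣ d' :=
    AddMonoid.exponent_dvd_of_forall_nsmul_eq_zero fun x => by
      ext i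
      simp
  refine ⟨S', hS', fun h => hT0 (by rw [h, Multiset.map_zero]), ?_, ?_⟩
  · rw [Multiset.card_map] at hTcard
    exact hTcard.trans (Nat.le_of_dvd hd' hexp)
  · rw [Nat.mul_div_cancel_left e hd']
    refine φ.injective (funext fun i => ?_)
    have hcoord : φ S'.sum i = (S'.map fun x => φ x i).sum :=
      map_multiset_sum ((Pi.evalAddMonoidHom _ i).comp φ.toAddMonoidHom) S'
    rw [_root_.map_nsmul, _root_.map_zero, Pi.smul_apply, Pi.zero_apply, hcoord]
    refine ZMod.nsmul_sum_eq_zero_of_sum_div_eq_zero hd' ?_ ?_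
    · intro y hy
      obtain ⟨x, hx, rfl⟩ := Multiset.mem_map.1 hy
      rw [← Pi.smul_apply, ← _root_.map_nsmul, hS x (Multiset.mem_of_le hS' hx), _root_.map_zero,
        Pi.zero_apply]
    · have := congrArg (Pi.evalAddMonoidHom _ i) hTsum
      rw [map_multiset_sum, Multiset.map_map, _root_.map_zero] at this
      rw [Multiset.map_map]
      exact this

/-- If `η(C_m^r) ≤ c(m-1)+1` for all `m ≥ 1`, then for every finite abelian group `G`
of rank `r` and all `d' ∣ d ∣ exp(G)`, one has `η_{(d',d)}(G) ≤ c(d'-1)+1`. -/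
theorem stmt5 (r : ℕ) (hr : 0 < r) (c : ℝ) (hc0 : 0 < c)
    (hc : ∀ m : ℕ, 0 < m → (etaC (Fin r → ZMod m) : ℝ) ≤ c * ((m : ℝ) - 1) + 1)
    (G : Type*) [AddCommGroup G] [Fintype G] (hG : HasRank G r)
    (d' d : ℕ) (hd' : 0 < d') (hd : 0 < d)
    (hd'd : d' ∣ d) (hdexp : d ∣ AddMonoid.exponent G) :
    (etaDD G d' d : ℝ) ≤ c * ((d' : ℝ) - 1) + 1 := by
  exact (Nat.cast_le.2 (etaDD_le_etaC hG hd' hd'd)).trans (hc d' hd')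
end

section
/- Let G be a finite abelian group of exponent n, let d > 1 be a divisor of n, let q = P^+(d) and ν = ν_q(d). Let S be a sequence over G all of whose elements have order exactly d, and let k be a positive integer with |S| ≥ (k−1)·(d/q^ν) + η_{(d/q^ν, d)}(G). Then S contains k pairwise disjoint non-empty subsequences S'_1, …, S'_k such that for all j ∈ {1,…,k}, σ(S'_j) ∈ G_{q^ν} and k(S'_j) ≤ 1/q^ν. -/
open Multiset Finset

/-- In a finite group, long enough multisets over `G_d` contain a non-empty submultiset of size at
most `d'` whose sum lies in `G_{d/d'}`, so that `etaDD G d' d` has its defining property. -/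
lemma exists_le_of_etaDD_le_card {G : Type*} [AddCommGroup G] [Fintype G] {d' d : ℕ}
    (hd' : 0 < d') (hdvd : d' ∣ d) {S : Multiset G} (hS : ∀ g ∈ S, d • g = 0)
    (hcard : etaDD G d' d ≤ Multiset.card S) :
    ∃ S' ≤ S, S' ≠ 0 ∧ Multiset.card S' ≤ d' ∧ (d / d') • S'.sum = 0 := by
  classical
  have hne : {t : ℕ | 0 < t ∧ ∀ S : Multiset G, (∀ g ∈ S, d • g = 0) → t ≤ Multiset.card S →
      ∃ S' ≤ S, S' ≠ 0 ∧ Multiset.card S' ≤ d' ∧ (d / d') • S'.sum = 0}.Nonempty := by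
    refine ⟨Fintype.card G * d', Nat.mul_pos Fintype.card_pos hd', fun S hS hle => ?_⟩
    obtain ⟨g, -, hg⟩ : ∃ g ∈ (Finset.univ : Finset G), d' ≤ S.count g := by
      refine Finset.exists_le_of_sum_le Finset.univ_nonempty ?_
      rw [Multiset.sum_count_eq_card (fun a _ => Finset.mem_univ a)]
      simpa using hle
    have hgS : g ∈ S := Multiset.count_pos.mp (hd'.trans_le hg)
    refine ⟨Multiset.replicate d' g, Multiset.le_count_iff_replicate_le.mp hg, ?_, by simp, ?_⟩
    · intro h
      have := congrArg Multiset.card h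
      simp at this
      omega
    · rw [Multiset.sum_replicate, smul_smul, Nat.div_mul_cancel hdvd, hS g hgS]
  exact (Nat.sInf_mem hne).2 S hS hcard

/-- If every submultiset of `S` of size at least `t` contains a submultiset of size at most `m`
satisfying `P`, then `k + 1` disjoint ones can be extracted greedily once `k * m + t ≤ card S`. -/
lemma exists_disjoint_family_of_card_le {α : Type*} {P : Multiset α → Prop} {m t : ℕ} (k : ℕ)
    (S : Multiset α)
    (h : ∀ U ≤ S, t ≤ Multiset.card U → ∃ V ≤ U, Multiset.card V ≤ m ∧ P V)
    (hcard : k * m + t ≤ Multiset.card S) :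
    ∃ T : Fin (k + 1) → Multiset α, (∑ j, T j) ≤ S ∧ ∀ j, Multiset.card (T j) ≤ m ∧ P (T j) := by
  induction k generalizing S with
  | zero =>
    obtain ⟨V, hV, hP⟩ := h S le_rfl (by omega)
    exact ⟨fun _ => V, by simpa using hV, fun _ => hP⟩
  | succ k ih =>
    obtain ⟨V, hV, hP⟩ := h S le_rfl (by omega)
    obtain ⟨R, rfl⟩ := Multiset.le_iff_exists_add.mp hV
    obtain ⟨T, hT, hTP⟩ := ih R (fun U hU => h U (hU.trans (Multiset.le_add_left R V))) (by
      rw [Multiset.card_add, add_mul] at hcard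
      have := hP.1
      omega)
    refine ⟨Fin.cons V T, ?_, fun j => ?_⟩
    · rw [Fin.sum_univ_succ]
      simpa using hT
    · refine Fin.cases ?_ (fun i => ?_) j
      · simpa using hP
      · simpa using hTP i

/-- The cross number of a multiset all of whose elements have order `d`. -/
lemma crossNum_eq_card_div {G : Type*} [AddCommGroup G] {S : Multiset G} {d : ℕ}
    (hS : ∀ g ∈ S, addOrderOf g = d) : crossNum S = (Multiset.card S : ℝ) / d := by
  have hmap : S.map (fun g => (1 : ℝ) / (addOrderOf g : ℝ)) = S.map fun _ => (1 : ℝ) / d :=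
    Multiset.map_congr rfl fun g hg => by rw [hS g hg]
  rw [crossNum, hmap, Multiset.map_const', Multiset.sum_replicate, nsmul_eq_mul, mul_one_div]


/-- Let `G` have exponent `n`, let `1 < d ∣ n`, `q = P⁺(d)`, `ν = ν_q(d)`. If all elements
of `S` have order exactly `d` and `|S| ≥ (k-1)·(d/q^ν) + η_{(d/q^ν, d)}(G)` with `k ≥ 1`,
then `S` contains `k` pairwise disjoint non-empty subsequences `S'_1, …, S'_k` with
`σ(S'_j) ∈ G_{q^ν}` and `k(S'_j) ≤ 1/q^ν` for all `j`. -/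
theorem stmt11 (G : Type*) [AddCommGroup G] [Fintype G]
    (n : ℕ) (hn : AddMonoid.exponent G = n)
    (d : ℕ) (hd1 : 1 < d) (hdn : d ∣ n)
    (q ν : ℕ) (hq : q = maxPF d) (hν : ν = d.factorization q)
    (S : Multiset G) (hS : ∀ g ∈ S, addOrderOf g = d)
    (k : ℕ) (hk : 0 < k)
    (hlen : (k - 1) * (d / q ^ ν) + etaDD G (d / q ^ ν) d ≤ Multiset.card S) :
    ∃ T : Fin k → Multiset G, (∑ j, T j) ≤ S ∧
      ∀ j, T j ≠ 0 ∧ q ^ ν • (T j).sum = 0 ∧ crossNum (T j) ≤ 1 / ((q : ℝ) ^ ν) := by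
  have hdvd : q ^ ν ∣ d := hν ▸ Nat.ordProj_dvd d q
  have hd0 : 0 < d := by omega
  have hqpos : 0 < q ^ ν := Nat.pos_of_dvd_of_pos hdvd hd0
  have hm : 0 < d / q ^ ν := Nat.div_pos (Nat.le_of_dvd hd0 hdvd) hqpos
  obtain ⟨k, rfl⟩ : ∃ l, k = l + 1 := ⟨k - 1, by omega⟩
  obtain ⟨T, hT, hTP⟩ := exists_disjoint_family_of_card_le
    (P := fun V => V ≠ 0 ∧ q ^ ν • V.sum = 0) k S (fun U hU hcard => by
      obtain ⟨V, hV, hV0, hVcard, hVsum⟩ := exists_le_of_etaDD_le_card hm (Nat.div_dvd_of_dvd hdvd)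
        (fun g hg => by rw [← hS g (Multiset.mem_of_le hU hg)]; exact addOrderOf_nsmul_eq_zero g)
        hcard
      rw [Nat.div_div_self hdvd hd0.ne'] at hVsum
      exact ⟨V, hV, hVcard, hV0, hVsum⟩) hlen
  refine ⟨T, hT, fun j => ⟨(hTP j).2.1, (hTP j).2.2, ?_⟩⟩
  have hTS : T j ≤ S :=
    (Finset.single_le_sum (fun i _ => Multiset.zero_le (T i)) (Finset.mem_univ j)).trans hT
  rw [crossNum_eq_card_div fun g hg => hS g (Multiset.mem_of_le hTS hg),
    div_le_div_iff₀ (by exact_mod_cast hd0) (by exact_mod_cast hqpos), one_mul]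
  have hle : Multiset.card (T j) * q ^ ν ≤ d :=
    (Nat.mul_le_mul_right _ (hTP j).1).trans (Nat.div_mul_cancel hdvd).le
  exact_mod_cast hle
end
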